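/- arXiv:math/0208129 — 3 statements merged into one kernel-verified Lean document; each statement's English description precedes it below -/
import Mathlib

section
/- Let a > 0, n ∈ ℕ, and let f : ℝⁿ → ℂ be continuous with f(x) = O(|x|^{-a}). Let α, β ∈ ℂ satisfy Re α > 0, Re β > 0 and Re(α + β) < min(a, n). Then I^β f and I^α(I^β f) are well defined by absolutely convergent integrals, and I^α(I^β f)(x) = (I^{α+β} f)(x) for every x ∈ ℝⁿ. -/
open Complex MeasureTheory Filter Asymptotics Set Metric

/-- `H_n(α) = 2^α π^(n/2) Γ(α/2) / Γ((n-α)/2)`. -/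
noncomputable def Hfun (n : ℕ) (α : ℂ) : ℂ :=
  (2 : ℂ) ^ α * (Real.pi : ℂ) ^ ((n : ℂ) / 2) * Complex.Gamma (α / 2) /
    Complex.Gamma (((n : ℂ) - α) / 2)

/-- The Riesz potential `(I^α f)(x) = (1/H_n(α)) ∫_{ℝⁿ} f(y) |x-y|^{α-n} dy`. -/
noncomputable def riesz (n : ℕ) (f : EuclideanSpace ℝ (Fin n) → ℂ) (α : ℂ)
    (x : EuclideanSpace ℝ (Fin n)) : ℂ :=
  (Hfun n α)⁻¹ * ∫ y : EuclideanSpace ℝ (Fin n), f y * (‖x - y‖ : ℂ) ^ (α - n)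

theorem integrable_prod_of_comp_mul_left {g : ℝ × ℝ → ℂ} {k : ℝ → ℝ}
    (hk : ∀ u, 0 < u → 0 < k u)
    (hg : AEStronglyMeasurable g ((volume.restrict (Ioi 0)).prod (volume.restrict (Ioi 0))))
    (h : Integrable (fun p : ℝ × ℝ => k p.1 • g (p.1, k p.1 * p.2))
      ((volume.restrict (Ioi 0)).prod (volume.restrict (Ioi 0)))) :
    Integrable g ((volume.restrict (Ioi 0)).prod (volume.restrict (Ioi 0))) ∧
    ∫ p, g p ∂((volume.restrict (Ioi 0)).prod (volume.restrict (Ioi 0))) =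
      ∫ p, k p.1 • g (p.1, k p.1 * p.2)
        ∂((volume.restrict (Ioi 0)).prod (volume.restrict (Ioi 0))) := by
  have hI : Integrable g ((volume.restrict (Ioi 0)).prod (volume.restrict (Ioi 0))) := by
    rw [integrable_prod_iff hg]
    constructor
    · filter_upwards [h.prod_right_ae, ae_restrict_mem measurableSet_Ioi] with u hu hu0
      have hku := hk u hu0
      have := hu.smul (k u)⁻¹
      simp only [Pi.smul_def, smul_smul, inv_mul_cancel₀ hku.ne', one_smul] at this
      have := (integrableOn_Ioi_comp_mul_left_iff (fun v => g (u, v)) 0 hku).1 this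
      rwa [mul_zero] at this
    · refine h.integral_norm_prod_left.congr ?_
      filter_upwards [ae_restrict_mem measurableSet_Ioi] with u hu0
      have hku := hk u hu0
      simp only [norm_smul, integral_const_mul, Real.norm_of_nonneg hku.le]
      simpa using integral_comp_mul_left_Ioi' (fun v => ‖g (u, v)‖) 0 hku
  refine ⟨hI, ?_⟩
  rw [integral_prod _ hI, integral_prod _ h]
  refine integral_congr_ae ?_
  filter_upwards [ae_restrict_mem measurableSet_Ioi] with u hu0
  have := integral_comp_mul_left_Ioi' (fun v => g (u, v)) 0 (hk u hu0)
  simp only [integral_smul]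
  simpa using this.symm

theorem mellinConvergent_one_add_cpow {a b : ℂ} (hb : 0 < b.re) (hab : b.re < a.re) :
    MellinConvergent (fun t : ℝ => ((1 + t : ℝ) : ℂ) ^ (-a)) b := by
  have hn : ∀ t : ℝ, 0 < t → ‖((1 + t : ℝ) : ℂ) ^ (-a)‖ = (1 + t) ^ (-a.re) := fun t ht => by
    rw [norm_cpow_eq_rpow_re_of_pos (by linarith), neg_re]
  refine mellinConvergent_of_isBigO_rpow (a := a.re) (b := 0) ?_ ?_ hab ?_ hb
  · refine ContinuousOn.locallyIntegrableOn (fun t ht => ?_) measurableSet_Ioi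
    have ht : 0 < t := ht
    exact ((continuousAt_ofReal_cpow_const (1 + t) (-a) (Or.inr (by linarith))).comp
      (f := fun t : ℝ => 1 + t) (by fun_prop)).continuousWithinAt
  · refine IsBigO.of_bound 1 ?_
    filter_upwards [eventually_gt_atTop 0] with t ht
    rw [hn t ht, one_mul, Real.norm_of_nonneg (by positivity)]
    exact Real.rpow_le_rpow_of_nonpos ht (by linarith) (by linarith)
  · refine IsBigO.of_bound 1 ?_
    filter_upwards [self_mem_nhdsWithin] with t ht
    have ht : 0 < t := ht
    rw [hn t ht, neg_zero, Real.rpow_zero, norm_one, one_mul]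
    exact Real.rpow_le_one_of_one_le_of_nonpos (by linarith) (by linarith)

theorem integrable_mul_comp_add_and_integral {a b : ℂ} (ha : 0 < a.re) (hb : 0 < b.re)
    {F : ℝ → ℂ} (hFm : Measurable F)
    (hF : MellinConvergent F (a + b)) :
    Integrable (fun p : ℝ × ℝ => (p.1 : ℂ) ^ (a - 1) * (p.2 : ℂ) ^ (b - 1) * F (p.1 + p.2))
      ((volume.restrict (Ioi 0)).prod (volume.restrict (Ioi 0))) ∧
    ∫ p : ℝ × ℝ, (p.1 : ℂ) ^ (a - 1) * (p.2 : ℂ) ^ (b - 1) * F (p.1 + p.2)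
      ∂((volume.restrict (Ioi 0)).prod (volume.restrict (Ioi 0))) =
      mellin (fun t : ℝ => ((1 + t : ℝ) : ℂ) ^ (-(a + b))) b * mellin F (a + b) := by
  have hae : ∀ᵐ p : ℝ × ℝ ∂((volume.restrict (Ioi 0)).prod (volume.restrict (Ioi 0))),
      0 < p.1 ∧ 0 < p.2 := by
    rw [Measure.prod_restrict]
    exact ae_restrict_mem (measurableSet_Ioi.prod measurableSet_Ioi)
  let H : ℝ × ℝ → ℂ := fun p => (p.1 : ℂ) ^ (b - 1) * (p.2 : ℂ) ^ (a + b - 1) * F (p.2 * (1 + p.1))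
  have hprod := (mellinConvergent_one_add_cpow (a := a + b) hb (by simp; linarith)).mul_prod hF
  have hprod_int := integral_prod_mul (μ := volume.restrict (Ioi (0 : ℝ)))
    (ν := volume.restrict (Ioi (0 : ℝ)))
    (fun t : ℝ => (t : ℂ) ^ (b - 1) • ((1 + t : ℝ) : ℂ) ^ (-(a + b)))
    (fun t : ℝ => (t : ℂ) ^ (a + b - 1) • F t)
  have e1 : (fun z : ℝ × ℝ => ((z.1 : ℂ) ^ (b - 1) • ((1 + z.1 : ℝ) : ℂ) ^ (-(a + b))) *
      ((z.2 : ℂ) ^ (a + b - 1) • F z.2)) =ᵐ[(volume.restrict (Ioi 0)).prod (volume.restrict (Ioi 0))]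
      fun p => (1 + p.1)⁻¹ • H (p.1, (1 + p.1)⁻¹ * p.2) := by
    filter_upwards [hae] with p hp
    have h1 : 0 < 1 + p.1 := by linarith [hp.1]
    simp only [H, smul_eq_mul]
    rw [ofReal_mul, mul_cpow_ofReal_nonneg (by positivity) hp.2.le,
      show (1 + p.1)⁻¹ * p.2 * (1 + p.1) = p.2 by field_simp, ofReal_inv,
      inv_cpow _ _ (by rw [arg_ofReal_of_nonneg h1.le]; exact Real.pi_pos.ne),
      show -(a + b) = -(a + b - 1) - 1 by ring, cpow_sub _ _ (ofReal_ne_zero.2 h1.ne'), cpow_neg,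
      cpow_one, real_smul, ofReal_inv]
    ring
  have hHm : Measurable H := by fun_prop
  obtain ⟨hH, hH_int⟩ := integrable_prod_of_comp_mul_left (g := H) (k := fun t => (1 + t)⁻¹)
    (fun u hu => by positivity) hHm.aestronglyMeasurable (hprod.congr e1)
  let G : ℝ × ℝ → ℂ := fun q => (q.1 : ℂ) ^ (a - 1) * (q.2 : ℂ) ^ (b - 1) * F (q.1 + q.2)
  have hGm : Measurable G := by fun_prop
  have e2 : H ∘ Prod.swap =ᵐ[(volume.restrict (Ioi 0)).prod (volume.restrict (Ioi 0))]
      fun p => p.1 • G (p.1, p.1 * p.2) := by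
    filter_upwards [hae] with p hp
    simp only [G, H, Function.comp, Prod.swap, ofReal_mul, real_smul]
    rw [mul_cpow_ofReal_nonneg hp.1.le hp.2.le, show p.1 + p.1 * p.2 = p.1 * (1 + p.2) by ring,
      show a + b - 1 = 1 + (a - 1) + (b - 1) by ring, cpow_add _ _ (ofReal_ne_zero.2 hp.1.ne'),
      cpow_add _ _ (ofReal_ne_zero.2 hp.1.ne'), cpow_one]
    ring
  obtain ⟨hG, hG_int⟩ := integrable_prod_of_comp_mul_left (g := G) (k := fun t => t)
    (fun u hu => hu) hGm.aestronglyMeasurable (hH.swap.congr e2)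
  refine ⟨hG, hG_int.trans ?_⟩
  rw [← integral_congr_ae e2]
  exact (integral_prod_swap H).trans (hH_int.trans ((integral_congr_ae e1).symm.trans hprod_int))

theorem mellinConvergent_exp_neg {a : ℂ} (ha : 0 < a.re) :
    MellinConvergent (fun t : ℝ => cexp (-(t : ℂ))) a := by
  refine (Complex.GammaIntegral_convergent ha).congr_fun (fun t _ => ?_) measurableSet_Ioi
  simp [mul_comm]

theorem mellin_exp_neg {a : ℂ} (ha : 0 < a.re) :
    mellin (fun t : ℝ => cexp (-(t : ℂ))) a = Gamma a := by
  rw [Gamma_eq_integral ha, GammaIntegral_eq_mellin]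
  simp [ofReal_exp]

theorem mellin_one_add_cpow_mul_Gamma {a b : ℂ} (ha : 0 < a.re) (hb : 0 < b.re) :
    mellin (fun t : ℝ => ((1 + t : ℝ) : ℂ) ^ (-(a + b))) b * Gamma (a + b) =
      Gamma a * Gamma b := by
  have hab : 0 < (a + b).re := by simp; linarith
  have h := (integrable_mul_comp_add_and_integral ha hb (F := fun t => cexp (-(t : ℂ)))
    (by fun_prop) (mellinConvergent_exp_neg hab)).2
  rw [mellin_exp_neg hab] at h
  rw [← h, ← mellin_exp_neg ha, ← mellin_exp_neg hb, mellin, mellin, ← integral_prod_mul]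
  congr 1 with p
  simp only [smul_eq_mul, ofReal_add, neg_add, exp_add]
  ring

theorem integral_mul_comp_add {a b : ℂ} (ha : 0 < a.re) (hb : 0 < b.re)
    {F : ℝ → ℂ} (hFm : Measurable F) (hF : MellinConvergent F (a + b)) :
    ∫ p : ℝ × ℝ, (p.1 : ℂ) ^ (a - 1) * (p.2 : ℂ) ^ (b - 1) * F (p.1 + p.2)
      ∂((volume.restrict (Ioi 0)).prod (volume.restrict (Ioi 0))) =
      Gamma a * Gamma b / Gamma (a + b) * mellin F (a + b) := by
  rw [(integrable_mul_comp_add_and_integral ha hb hFm hF).2, ← mellin_one_add_cpow_mul_Gamma ha hb,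
    mul_div_cancel_right₀]
  exact Gamma_ne_zero_of_re_pos (by simp; linarith)

/-- The Gaussian `(π u)^(-n/2) exp (-r² / u)`, a heat kernel on `ℝⁿ` at distance `r`. -/
noncomputable def heatKernel (n : ℕ) (u r : ℝ) : ℝ :=
  (Real.pi * u) ^ (-(n / 2 : ℝ)) * Real.exp (-(r ^ 2 / u))

theorem heatKernel_nonneg (n : ℕ) {u : ℝ} (hu : 0 < u) (r : ℝ) : 0 ≤ heatKernel n u r := by
  unfold heatKernel
  have := Real.pi_pos
  positivity

theorem hasMellin_heatKernel (n : ℕ) {r : ℝ} (hr : 0 < r) {s : ℂ} (hs : (2 * s).re < n) :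
    HasMellin (fun u => (heatKernel n u r : ℂ)) s
      ((Real.pi : ℂ) ^ (-(n / 2) : ℂ) * Gamma ((n - 2 * s) / 2) * (r : ℂ) ^ (2 * s - n)) := by
  have hs' : 0 < (-(s + -(n / 2 : ℂ))).re := by
    have h2 : (2 * s).re = 2 * s.re := by simp
    have h3 : ((n : ℂ) / 2).re = n / 2 := by simp
    rw [neg_re, add_re, neg_re, h3]
    linarith
  have hr2 : 0 < r ^ 2 := by positivity
  let f : ℝ → ℂ := fun t => cexp (-((r ^ 2 * t : ℝ) : ℂ))
  have hcongr : ∀ t ∈ Ioi (0 : ℝ), (t : ℂ) ^ (s - 1) • (heatKernel n t r : ℂ) =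
      (t : ℂ) ^ (s - 1) • ((Real.pi : ℂ) ^ (-(n / 2) : ℂ) •
        ((t : ℂ) ^ (-(n / 2 : ℂ)) • f (t⁻¹))) := by
    intro t ht
    have ht : 0 < t := ht
    simp only [heatKernel, f, smul_eq_mul]
    rw [Real.mul_rpow Real.pi_pos.le ht.le]
    push_cast [ofReal_cpow Real.pi_pos.le, ofReal_cpow ht.le, div_eq_mul_inv]
    ring
  have hf : MellinConvergent f (-(s + -(n / 2 : ℂ))) :=
    (MellinConvergent.comp_mul_left (f := fun t : ℝ => cexp (-(t : ℂ))) hr2).2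
      (mellinConvergent_exp_neg hs')
  have hf_inv : MellinConvergent (fun t => f t⁻¹) (s + -(n / 2 : ℂ)) := by
    have := (MellinConvergent.comp_rpow (f := f) (s := s + -(n / 2 : ℂ)) (a := -1) (by norm_num)).2
      (by simpa [div_neg] using hf)
    simpa only [Real.rpow_neg_one] using this
  constructor
  · exact (((MellinConvergent.cpow_smul (f := fun t => f t⁻¹)).2 hf_inv).const_smul _).congr_fun
      (fun t ht => (hcongr t ht).symm) measurableSet_Ioi
  · rw [mellin, setIntegral_congr_fun measurableSet_Ioi hcongr, ← mellin,
      mellin_const_smul, mellin_cpow_smul, mellin_comp_inv,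
      mellin_comp_mul_left (fun t : ℝ => cexp (-(t : ℂ))) _ hr2, mellin_exp_neg hs', smul_eq_mul,
      smul_eq_mul, neg_neg, ofReal_pow, ← cpow_nat_mul' (by
        rw [arg_ofReal_of_nonneg hr.le]; simp [Real.pi_pos]) (by
        rw [arg_ofReal_of_nonneg hr.le]; simp [Real.pi_pos.le])]
    rw [show (n - 2 * s) / 2 = -(s + -(n / 2 : ℂ)) by ring,
      show 2 * s - n = ((2 : ℕ) : ℂ) * (s + -(n / 2 : ℂ)) by push_cast; ring]
    ring

theorem norm_sq_div_add_norm_sq_div {V : Type*} [NormedAddCommGroup V] [InnerProductSpace ℝ V]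
    {u v : ℝ} (hu : 0 < u) (hv : 0 < v) (x y z : V) :
    ‖x - y‖ ^ 2 / u + ‖y - z‖ ^ 2 / v =
      ((u + v) / (u * v)) * ‖y - ((v / (u + v)) • x + (u / (u + v)) • z)‖ ^ 2 +
        ‖x - z‖ ^ 2 / (u + v) := by
  have hy : y - ((v / (u + v)) • x + (u / (u + v)) • z) =
      (u / (u + v)) • (y - z) - (v / (u + v)) • (x - y) := by
    have : y = (u / (u + v) + v / (u + v)) • y := by
      rw [← add_div, div_self (by positivity), one_smul]
    nth_rw 1 [this]
    module
  have hxz : x - z = (y - z) + (x - y) := by abel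
  rw [hy, hxz]
  generalize x - y = p, y - z = q
  rw [norm_sub_sq_real, norm_add_sq_real, norm_smul, norm_smul, real_inner_smul_left,
    real_inner_smul_right, Real.norm_of_nonneg (by positivity), Real.norm_of_nonneg (by positivity)]
  field_simp
  ring

theorem integrable_exp_neg_mul_norm_sq {V : Type*} [NormedAddCommGroup V] [InnerProductSpace ℝ V]
    [FiniteDimensional ℝ V] [MeasurableSpace V] [BorelSpace V] {b : ℝ} (hb : 0 < b) :
    Integrable (fun v : V => Real.exp (-b * ‖v‖ ^ 2)) := by
  refine (GaussianFourier.integrable_cexp_neg_mul_sq_norm_add (V := V) (b := b)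
    (by simpa using hb) 0 0).norm.congr (.of_forall fun v => ?_)
  simp [norm_exp, ← ofReal_pow]

theorem heatKernel_mul_heatKernel (n : ℕ) {u v : ℝ} (hu : 0 < u) (hv : 0 < v)
    (x y z : EuclideanSpace ℝ (Fin n)) :
    heatKernel n u ‖x - y‖ * heatKernel n v ‖y - z‖ =
      ((Real.pi * u) ^ (-(n / 2 : ℝ)) * (Real.pi * v) ^ (-(n / 2 : ℝ)) *
        Real.exp (-(‖x - z‖ ^ 2 / (u + v)))) *
      Real.exp (-((u + v) / (u * v)) * ‖y - ((v / (u + v)) • x + (u / (u + v)) • z)‖ ^ 2) := by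
  have h : Real.exp (-(‖x - y‖ ^ 2 / u)) * Real.exp (-(‖y - z‖ ^ 2 / v)) =
      Real.exp (-(‖x - z‖ ^ 2 / (u + v))) *
      Real.exp (-((u + v) / (u * v)) * ‖y - ((v / (u + v)) • x + (u / (u + v)) • z)‖ ^ 2) := by
    rw [← Real.exp_add, ← Real.exp_add, ← neg_add, norm_sq_div_add_norm_sq_div hu hv]
    congr 1
    ring
  simp only [heatKernel]
  rw [mul_mul_mul_comm, h]
  ring

theorem integrable_heatKernel_mul_heatKernel (n : ℕ) {u v : ℝ} (hu : 0 < u) (hv : 0 < v)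
    (x z : EuclideanSpace ℝ (Fin n)) :
    Integrable (fun y => heatKernel n u ‖x - y‖ * heatKernel n v ‖y - z‖) := by
  simp only [heatKernel_mul_heatKernel n hu hv]
  exact ((integrable_exp_neg_mul_norm_sq (b := (u + v) / (u * v)) (by positivity)).comp_sub_right
    _).const_mul _

theorem integral_heatKernel_mul_heatKernel (n : ℕ) {u v : ℝ} (hu : 0 < u) (hv : 0 < v)
    (x z : EuclideanSpace ℝ (Fin n)) :
    ∫ y, heatKernel n u ‖x - y‖ * heatKernel n v ‖y - z‖ = heatKernel n (u + v) ‖x - z‖ := by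
  have hpi := Real.pi_pos
  simp only [heatKernel_mul_heatKernel n hu hv]
  rw [integral_const_mul, integral_sub_right_eq_self
    (fun y : EuclideanSpace ℝ (Fin n) => Real.exp (-((u + v) / (u * v)) * ‖y‖ ^ 2)),
    GaussianFourier.integral_rexp_neg_mul_sq_norm (by positivity), finrank_euclideanSpace_fin,
    heatKernel, mul_right_comm, ← Real.mul_rpow (by positivity) (by positivity),
    Real.rpow_neg (by positivity), ← Real.inv_rpow (by positivity),
    ← Real.mul_rpow (by positivity) (by positivity), Real.rpow_neg (by positivity),
    ← Real.inv_rpow (by positivity)]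
  congr 2
  field_simp

theorem setIntegral_cpow_mul_heatKernel (n : ℕ) {r : ℝ} (hr : 0 < r) {α : ℂ} (hα : α.re < n) :
    ∫ u in Ioi (0 : ℝ), (u : ℂ) ^ (α / 2 - 1) * (heatKernel n u r : ℂ) =
      (Real.pi : ℂ) ^ (-(n / 2) : ℂ) * Gamma ((n - α) / 2) * (r : ℂ) ^ (α - n) := by
  have h2 : 2 * (α / 2) = α := by ring
  have := (hasMellin_heatKernel n hr (s := α / 2) (by rwa [h2])).2
  rwa [h2] at this

section Composition

variable {n : ℕ} {α β : ℂ}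

theorem integrable_cpow_mul_heatKernel_mul_heatKernel (hα : 0 < α.re) (hβ : 0 < β.re)
    (hαβ : (α + β).re < n) {x z : EuclideanSpace ℝ (Fin n)} (hxz : x ≠ z) :
    Integrable (fun q : (ℝ × ℝ) × EuclideanSpace ℝ (Fin n) =>
      (q.1.1 : ℂ) ^ (α / 2 - 1) * (q.1.2 : ℂ) ^ (β / 2 - 1) *
        ((heatKernel n q.1.1 ‖x - q.2‖ * heatKernel n q.1.2 ‖q.2 - z‖ : ℝ) : ℂ))
      (((volume.restrict (Ioi 0)).prod (volume.restrict (Ioi 0))).prod volume) := by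
  have hm : Measurable (fun q : (ℝ × ℝ) × EuclideanSpace ℝ (Fin n) =>
      (q.1.1 : ℂ) ^ (α / 2 - 1) * (q.1.2 : ℂ) ^ (β / 2 - 1) *
        ((heatKernel n q.1.1 ‖x - q.2‖ * heatKernel n q.1.2 ‖q.2 - z‖ : ℝ) : ℂ)) := by
    unfold heatKernel
    fun_prop
  have hae : ∀ᵐ p : ℝ × ℝ ∂((volume.restrict (Ioi 0)).prod (volume.restrict (Ioi 0))),
      0 < p.1 ∧ 0 < p.2 := by
    rw [Measure.prod_restrict]
    exact ae_restrict_mem (measurableSet_Ioi.prod measurableSet_Ioi)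
  have hr : 0 < ‖x - z‖ := norm_pos_iff.2 (sub_ne_zero.2 hxz)
  have hF := (integrable_mul_comp_add_and_integral (a := α / 2) (b := β / 2)
    (F := fun u => (heatKernel n u ‖x - z‖ : ℂ)) (by simpa using hα) (by simpa using hβ)
    (by unfold heatKernel; fun_prop) (hasMellin_heatKernel n hr (by
      rwa [show 2 * (α / 2 + β / 2) = α + β by ring])).1).1
  rw [integrable_prod_iff hm.aestronglyMeasurable]
  constructor
  · filter_upwards [hae] with p hp
    exact (integrable_heatKernel_mul_heatKernel n hp.1 hp.2 x z).ofReal.const_mul _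
  · refine hF.norm.congr ?_
    filter_upwards [hae] with p hp
    have hnn : ∀ y, 0 ≤ heatKernel n p.1 ‖x - y‖ * heatKernel n p.2 ‖y - z‖ := fun y =>
      mul_nonneg (heatKernel_nonneg n hp.1 _) (heatKernel_nonneg n hp.2 _)
    simp only [norm_mul _ (ofReal _), norm_real]
    simp only [Real.norm_of_nonneg (hnn _)]
    rw [integral_const_mul, integral_heatKernel_mul_heatKernel n hp.1 hp.2,
      Real.norm_of_nonneg (heatKernel_nonneg n (add_pos hp.1 hp.2) _)]

theorem integral_integral_cpow_mul_heatKernel (hα : 0 < α.re) (hβ : 0 < β.re)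
    (hαβ : (α + β).re < n) {x z : EuclideanSpace ℝ (Fin n)} (hxz : x ≠ z) :
    ∫ p : ℝ × ℝ, (∫ y : EuclideanSpace ℝ (Fin n),
        (p.1 : ℂ) ^ (α / 2 - 1) * (p.2 : ℂ) ^ (β / 2 - 1) *
          ((heatKernel n p.1 ‖x - y‖ * heatKernel n p.2 ‖y - z‖ : ℝ) : ℂ))
      ∂((volume.restrict (Ioi 0)).prod (volume.restrict (Ioi 0))) =
    Gamma (α / 2) * Gamma (β / 2) / Gamma ((α + β) / 2) *
      ((Real.pi : ℂ) ^ (-(n / 2) : ℂ) * Gamma ((n - (α + β)) / 2) *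
        (‖x - z‖ : ℂ) ^ (α + β - n)) := by
  have hae : ∀ᵐ p : ℝ × ℝ ∂((volume.restrict (Ioi 0)).prod (volume.restrict (Ioi 0))),
      0 < p.1 ∧ 0 < p.2 := by
    rw [Measure.prod_restrict]
    exact ae_restrict_mem (measurableSet_Ioi.prod measurableSet_Ioi)
  have hr : 0 < ‖x - z‖ := norm_pos_iff.2 (sub_ne_zero.2 hxz)
  have h2 : 2 * (α / 2 + β / 2) = α + β := by ring
  have hM := hasMellin_heatKernel n hr (s := α / 2 + β / 2) (by rwa [h2])
  have hI := integral_mul_comp_add (a := α / 2) (b := β / 2)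
    (F := fun u => (heatKernel n u ‖x - z‖ : ℂ)) (by simpa using hα) (by simpa using hβ)
    (by unfold heatKernel; fun_prop) hM.1
  rw [hM.2, h2, ← add_div] at hI
  rw [← hI]
  refine integral_congr_ae ?_
  filter_upwards [hae] with p hp
  rw [integral_const_mul, integral_complex_ofReal, integral_heatKernel_mul_heatKernel n hp.1 hp.2]

theorem setIntegral_prod_cpow_mul_heatKernel (hα : α.re < n) (hβ : β.re < n)
    {x y z : EuclideanSpace ℝ (Fin n)} (hxy : y ≠ x) (hyz : y ≠ z) :
    ∫ p : ℝ × ℝ, (p.1 : ℂ) ^ (α / 2 - 1) * (p.2 : ℂ) ^ (β / 2 - 1) *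
        ((heatKernel n p.1 ‖x - y‖ * heatKernel n p.2 ‖y - z‖ : ℝ) : ℂ)
      ∂((volume.restrict (Ioi 0)).prod (volume.restrict (Ioi 0))) =
    ((Real.pi : ℂ) ^ (-(n / 2) : ℂ) * Gamma ((n - α) / 2) *
      ((Real.pi : ℂ) ^ (-(n / 2) : ℂ) * Gamma ((n - β) / 2))) *
      ((‖x - y‖ : ℂ) ^ (α - n) * (‖y - z‖ : ℂ) ^ (β - n)) := by
  rw [mul_mul_mul_comm,
    ← setIntegral_cpow_mul_heatKernel n (norm_pos_iff.2 (sub_ne_zero.2 hxy.symm)) hα,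
    ← setIntegral_cpow_mul_heatKernel n (norm_pos_iff.2 (sub_ne_zero.2 hyz)) hβ,
    ← integral_prod_mul]
  refine integral_congr_ae (.of_forall fun p => ?_)
  simp only [ofReal_mul]
  ring

theorem pi_cpow_mul_Gamma_ne_zero (hα : α.re < n) :
    (Real.pi : ℂ) ^ (-(n / 2) : ℂ) * Gamma ((n - α) / 2) ≠ 0 :=
  mul_ne_zero (by simp [cpow_eq_zero_iff, Real.pi_ne_zero])
    (Gamma_ne_zero_of_re_pos (by simpa using hα))

theorem integrable_riesz_kernel_mul (hn : 0 < n) (hα : 0 < α.re) (hβ : 0 < β.re)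
    (hαβ : (α + β).re < n) {x z : EuclideanSpace ℝ (Fin n)} (hxz : x ≠ z) :
    Integrable (fun y => (‖x - y‖ : ℂ) ^ (α - n) * (‖y - z‖ : ℂ) ^ (β - n)) := by
  have : Nonempty (Fin n) := ⟨⟨0, hn⟩⟩
  rw [add_re] at hαβ
  have h := (integrable_cpow_mul_heatKernel_mul_heatKernel hα hβ (by simpa) hxz).integral_prod_right
  refine (integrable_const_mul_iff (IsUnit.mk0 _ (mul_ne_zero
    (pi_cpow_mul_Gamma_ne_zero (n := n) (α := α) (by linarith))
    (pi_cpow_mul_Gamma_ne_zero (n := n) (α := β) (by linarith)))) _).1 (h.congr ?_)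
  filter_upwards [volume.ae_ne x, volume.ae_ne z] with y hyx hyz
  exact setIntegral_prod_cpow_mul_heatKernel (by linarith) (by linarith) hyx hyz

theorem inv_Hfun (n : ℕ) (α : ℂ) : (Hfun n α)⁻¹ = ((2 : ℂ) ^ α * Gamma (α / 2))⁻¹ *
    ((Real.pi : ℂ) ^ (-(n / 2) : ℂ) * Gamma ((n - α) / 2)) := by
  rw [Hfun, cpow_neg]
  simp only [mul_inv, inv_inv, div_eq_mul_inv]
  ring

theorem integral_riesz_kernel_mul (hn : 0 < n) (hα : 0 < α.re) (hβ : 0 < β.re)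
    (hαβ : (α + β).re < n) {x z : EuclideanSpace ℝ (Fin n)} (hxz : x ≠ z) :
    (Hfun n α)⁻¹ * (Hfun n β)⁻¹ *
      ∫ y, (‖x - y‖ : ℂ) ^ (α - n) * (‖y - z‖ : ℂ) ^ (β - n) =
    (Hfun n (α + β))⁻¹ * (‖x - z‖ : ℂ) ^ (α + β - n) := by
  have : Nonempty (Fin n) := ⟨⟨0, hn⟩⟩
  have hαβ' : α.re + β.re < n := by simpa using hαβ
  have h := integral_integral_swap (f := fun (p : ℝ × ℝ) (y : EuclideanSpace ℝ (Fin n)) =>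
    (p.1 : ℂ) ^ (α / 2 - 1) * (p.2 : ℂ) ^ (β / 2 - 1) *
      ((heatKernel n p.1 ‖x - y‖ * heatKernel n p.2 ‖y - z‖ : ℝ) : ℂ))
    (integrable_cpow_mul_heatKernel_mul_heatKernel hα hβ hαβ hxz)
  rw [integral_integral_cpow_mul_heatKernel hα hβ hαβ hxz,
    integral_congr_ae (g := fun y => ((Real.pi : ℂ) ^ (-(n / 2) : ℂ) * Gamma ((n - α) / 2) *
      ((Real.pi : ℂ) ^ (-(n / 2) : ℂ) * Gamma ((n - β) / 2))) *
      ((‖x - y‖ : ℂ) ^ (α - n) * (‖y - z‖ : ℂ) ^ (β - n))) (by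
        filter_upwards [volume.ae_ne x, volume.ae_ne z] with y hyx hyz
        exact setIntegral_prod_cpow_mul_heatKernel (by linarith) (by linarith) hyx hyz),
    integral_const_mul] at h
  have hΓα : Gamma (α / 2) ≠ 0 := Gamma_ne_zero_of_re_pos (by simpa using hα)
  have hΓβ : Gamma (β / 2) ≠ 0 := Gamma_ne_zero_of_re_pos (by simpa using hβ)
  have h2 : (2 : ℂ) ^ (α + β) = 2 ^ α * 2 ^ β := cpow_add _ _ two_ne_zero
  rw [inv_Hfun, inv_Hfun, inv_Hfun, mul_mul_mul_comm, mul_assoc, ← h, h2]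
  generalize Gamma (α / 2) = A at *
  generalize Gamma (β / 2) = B at *
  rw [mul_inv, mul_inv, mul_inv, mul_inv]
  linear_combination ((2 : ℂ) ^ α)⁻¹ * ((2 : ℂ) ^ β)⁻¹ * (Gamma ((α + β) / 2))⁻¹ *
    ((Real.pi : ℂ) ^ (-(n / 2) : ℂ) * Gamma ((n - (α + β)) / 2) *
        (‖x - z‖ : ℂ) ^ (α + β - n)) * (B⁻¹ * B * inv_mul_cancel₀ hΓα + inv_mul_cancel₀ hΓβ)

theorem exists_integral_norm_riesz_kernel_mul (hn : 0 < n) (hα : 0 < α.re) (hβ : 0 < β.re)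
    (hαβ : (α + β).re < n) : ∃ C : ℝ, ∀ x z : EuclideanSpace ℝ (Fin n), x ≠ z →
      ∫ y, ‖(‖x - y‖ : ℂ) ^ (α - n) * (‖y - z‖ : ℂ) ^ (β - n)‖ =
        C * ‖(‖x - z‖ : ℂ) ^ (α + β - n)‖ := by
  have hαβ' : α.re + β.re < n := by simpa using hαβ
  have hpow : ∀ {γ : ℂ}, γ.re < n → ∀ w : EuclideanSpace ℝ (Fin n),
      (‖w‖ : ℂ) ^ ((γ.re : ℂ) - n) = (‖(‖w‖ : ℂ) ^ (γ - n)‖ : ℝ) := fun {γ} hγ w => by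
    rw [norm_cpow_eq_rpow_re_of_nonneg (norm_nonneg _) (by simp; linarith),
      ofReal_cpow (norm_nonneg _)]
    simp
  have hH : ∀ {γ : ℂ}, 0 < γ.re → γ.re < n → (Hfun n γ.re)⁻¹ ≠ 0 := fun {γ} h0 h1 => by
    rw [inv_Hfun]
    refine mul_ne_zero (inv_ne_zero (mul_ne_zero (by simp [cpow_eq_zero_iff])
      (Gamma_ne_zero_of_re_pos (by simpa using h0)))) (pi_cpow_mul_Gamma_ne_zero (by simpa))
  have hHα := hH hα (by linarith)
  have hHβ := hH hβ (by linarith)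
  refine ⟨‖((Hfun n α.re)⁻¹ * (Hfun n β.re)⁻¹)⁻¹ * (Hfun n (α + β).re)⁻¹‖, fun x z hxz => ?_⟩
  have h := integral_riesz_kernel_mul (α := α.re) (β := β.re) hn (by simpa) (by simpa) (by simpa)
    hxz
  rw [← ofReal_add, ← add_re, hpow hαβ] at h
  simp only [hpow (show α.re < n by linarith), hpow (show β.re < n by linarith), ← ofReal_mul,
    ← norm_mul] at h
  rw [integral_complex_ofReal, ← eq_inv_mul_iff_mul_eq₀ (mul_ne_zero hHα hHβ), ← mul_assoc] at h
  have h' := congrArg norm h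
  rw [norm_mul _ (ofReal _), norm_real, norm_real, norm_norm, Real.norm_of_nonneg
    (integral_nonneg fun y => norm_nonneg _)] at h'
  exact h'

end Composition

theorem integrable_one_add_norm_cpow_mul_norm_cpow {n : ℕ} (hn : 0 < n) {a : ℝ} {γ : ℂ}
    (hγ : 0 < γ.re) (hγa : γ.re < a) :
    Integrable (fun y : EuclideanSpace ℝ (Fin n) =>
      ((1 + ‖y‖ : ℝ) : ℂ) ^ (-(a : ℂ)) * (‖y‖ : ℂ) ^ (γ - n)) := by
  have : Nonempty (Fin n) := ⟨⟨0, hn⟩⟩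
  refine (integrable_fun_norm_addHaar (volume : Measure (EuclideanSpace ℝ (Fin n)))
    (f := fun r : ℝ => ((1 + r : ℝ) : ℂ) ^ (-(a : ℂ)) * (r : ℂ) ^ (γ - n))).2 ?_
  refine (mellinConvergent_one_add_cpow (a := a) hγ (by simpa)).congr_fun (fun r hr => ?_)
    measurableSet_Ioi
  have hr : (r : ℂ) ≠ 0 := ofReal_ne_zero.2 (ne_of_gt hr)
  simp only [finrank_euclideanSpace_fin, smul_eq_mul, real_smul, ofReal_pow]
  rw [show γ - 1 = ((n - 1 : ℕ) : ℂ) + (γ - n) by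
    rw [Nat.cast_sub (by omega : 1 ≤ n)]; push_cast; ring, cpow_add _ _ hr, cpow_natCast]
  ring

theorem exists_norm_le_mul_one_add_norm_rpow {E F : Type*} [NormedAddCommGroup E] [ProperSpace E]
    [NormedAddCommGroup F] {a : ℝ} (ha : 0 < a) {f : E → F} (hfc : Continuous f)
    (hdecay : f =O[cocompact E] fun y => ‖y‖ ^ (-a)) :
    ∃ C : ℝ, 0 ≤ C ∧ ∀ y, ‖f y‖ ≤ C * (1 + ‖y‖) ^ (-a) := by
  obtain ⟨c, hc⟩ := hdecay.bound
  have hlarge : ∀ᶠ y in cocompact E, 1 ≤ ‖y‖ :=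
    (tendsto_norm_cocompact_atTop (E := E)).eventually_ge_atTop 1
  obtain ⟨K, hK, hKsub⟩ := mem_cocompact.1 (hc.and hlarge)
  obtain ⟨M, hM⟩ := hK.exists_bound_of_continuousOn (f := fun y => (1 + ‖y‖) ^ a * ‖f y‖)
    (Continuous.continuousOn ((Continuous.rpow_const (by fun_prop) fun y =>
      Or.inr ha.le).mul hfc.norm))
  refine ⟨max 0 (max M (|c| * 2 ^ a)), le_max_left _ _, fun y => ?_⟩
  have hpos : 0 < 1 + ‖y‖ := by positivity
  suffices h : (1 + ‖y‖) ^ a * ‖f y‖ ≤ max 0 (max M (|c| * 2 ^ a)) by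
    rw [Real.rpow_neg hpos.le, ← div_eq_mul_inv, le_div_iff₀ (by positivity), mul_comm]
    exact h
  by_cases hy : y ∈ K
  · exact (le_abs_self _).trans ((hM y hy).trans ((le_max_left _ _).trans (le_max_right _ _)))
  · obtain ⟨h1, h2⟩ := hKsub hy
    have hy0 : 0 < ‖y‖ := by linarith
    refine le_trans ?_ ((le_max_right M _).trans (le_max_right _ _))
    calc (1 + ‖y‖) ^ a * ‖f y‖ ≤ (2 * ‖y‖) ^ a * (|c| * ‖y‖ ^ (-a)) := by
          gcongr
          · linarith
          · refine h1.trans ?_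
            rw [Real.norm_of_nonneg (by positivity)]
            gcongr
            exact le_abs_self c
      _ = |c| * 2 ^ a := by
          rw [Real.mul_rpow (by norm_num) hy0.le, Real.rpow_neg hy0.le]
          field_simp

theorem integrable_mul_riesz_kernel {n : ℕ} (hn : 0 < n) {a : ℝ} (ha : 0 < a)
    {f : EuclideanSpace ℝ (Fin n) → ℂ} (hfc : Continuous f)
    (hdecay : f =O[cocompact (EuclideanSpace ℝ (Fin n))] fun y => ‖y‖ ^ (-a))
    {γ : ℂ} (hγ : 0 < γ.re) (hγa : γ.re < a) (x : EuclideanSpace ℝ (Fin n)) :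
    Integrable (fun y => f y * (‖x - y‖ : ℂ) ^ (γ - n)) := by
  obtain ⟨C, hC, hf⟩ := exists_norm_le_mul_one_add_norm_rpow ha hfc hdecay
  have hm : Measurable (fun y => f y * (‖x - y‖ : ℂ) ^ (γ - n)) := by
    have := hfc.measurable
    fun_prop
  refine ((((integrable_one_add_norm_cpow_mul_norm_cpow hn hγ hγa).comp_sub_left x).norm).const_mul
    (C * (1 + ‖x‖) ^ a)).mono' hm.aestronglyMeasurable (.of_forall fun y => ?_)
  have hpos : 0 < 1 + ‖x - y‖ := by positivity
  rw [norm_mul, norm_mul, norm_cpow_eq_rpow_re_of_pos hpos, neg_re, ofReal_re, ← mul_assoc]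
  gcongr
  refine (hf y).trans ?_
  rw [mul_assoc]
  gcongr
  rw [Real.rpow_neg (by positivity), Real.rpow_neg (by positivity), ← div_eq_mul_inv,
    le_div_iff₀ (by positivity), inv_mul_le_iff₀ (by positivity),
    ← Real.mul_rpow (by positivity) (by positivity)]
  gcongr
  have := norm_sub_le x y
  nlinarith [norm_nonneg x, norm_nonneg y]

theorem integrable_prod_riesz_kernel {n : ℕ} (hn : 0 < n) {a : ℝ} (ha : 0 < a)
    {f : EuclideanSpace ℝ (Fin n) → ℂ} (hfc : Continuous f)
    (hdecay : f =O[cocompact (EuclideanSpace ℝ (Fin n))] fun y => ‖y‖ ^ (-a))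
    {α β : ℂ} (hα : 0 < α.re) (hβ : 0 < β.re) (hαβa : (α + β).re < a) (hαβn : (α + β).re < n)
    (x : EuclideanSpace ℝ (Fin n)) :
    Integrable (fun p : EuclideanSpace ℝ (Fin n) × EuclideanSpace ℝ (Fin n) =>
      f p.2 * ((‖x - p.1‖ : ℂ) ^ (α - n) * (‖p.1 - p.2‖ : ℂ) ^ (β - n)))
      (volume.prod volume) := by
  have : Nonempty (Fin n) := ⟨⟨0, hn⟩⟩
  have hαβ0 : 0 < (α + β).re := by simpa using add_pos hα hβ
  have hm : Measurable (fun p : EuclideanSpace ℝ (Fin n) × EuclideanSpace ℝ (Fin n) =>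
      f p.2 * ((‖x - p.1‖ : ℂ) ^ (α - n) * (‖p.1 - p.2‖ : ℂ) ^ (β - n))) := by
    have := hfc.measurable
    fun_prop
  obtain ⟨C, hC⟩ := exists_integral_norm_riesz_kernel_mul hn hα hβ hαβn
  rw [integrable_prod_iff' hm.aestronglyMeasurable]
  constructor
  · filter_upwards [volume.ae_ne x] with z hz
    exact (integrable_riesz_kernel_mul hn hα hβ hαβn hz.symm).const_mul _
  · refine ((integrable_mul_riesz_kernel hn ha hfc hdecay hαβ0 hαβa x).norm.const_mul C).congr ?_
    filter_upwards [volume.ae_ne x] with z hz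
    simp only [norm_mul (f z)]
    rw [integral_const_mul, hC x z hz.symm]
    ring

theorem stmt_7 (a : ℝ) (ha : 0 < a) (n : ℕ) (hn : 0 < n)
    (f : EuclideanSpace ℝ (Fin n) → ℂ) (hfc : Continuous f)
    (hdecay : f =O[cocompact (EuclideanSpace ℝ (Fin n))] fun y => ‖y‖ ^ (-a))
    (α β : ℂ) (hα : 0 < α.re) (hβ : 0 < β.re) (hαβ : (α + β).re < min a n) :
    (∀ x : EuclideanSpace ℝ (Fin n),
      Integrable (fun y => f y * (‖x - y‖ : ℂ) ^ (β - n))) ∧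
    (∀ x : EuclideanSpace ℝ (Fin n),
      Integrable (fun y => riesz n f β y * (‖x - y‖ : ℂ) ^ (α - n))) ∧
    ∀ x : EuclideanSpace ℝ (Fin n), riesz n (riesz n f β) α x = riesz n f (α + β) x := by
  have : Nonempty (Fin n) := ⟨⟨0, hn⟩⟩
  have hαβa := hαβ.trans_le (min_le_left _ _)
  have hαβn := hαβ.trans_le (min_le_right _ _)
  have hprod := integrable_prod_riesz_kernel hn ha hfc hdecay hα hβ hαβa hαβn
  have hinner : ∀ x y : EuclideanSpace ℝ (Fin n), riesz n f β y * (‖x - y‖ : ℂ) ^ (α - n) =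
      (Hfun n β)⁻¹ * ∫ z, f z * ((‖x - y‖ : ℂ) ^ (α - n) * (‖y - z‖ : ℂ) ^ (β - n)) := by
    intro x y
    rw [riesz, mul_assoc, ← integral_mul_const]
    congr 2 with z
    ring
  refine ⟨fun x => ?_, fun x => ?_, fun x => ?_⟩
  · refine integrable_mul_riesz_kernel hn ha hfc hdecay hβ ?_ x
    rw [add_re] at hαβa
    linarith
  · simp only [hinner]
    exact (hprod x).integral_prod_left.const_mul _
  · rw [riesz]
    simp only [hinner]
    rw [integral_const_mul, integral_integral_swap (f := fun y z =>
      f z * ((‖x - y‖ : ℂ) ^ (α - n) * (‖y - z‖ : ℂ) ^ (β - n))) (hprod x), ← mul_assoc,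
      ← integral_const_mul, riesz, ← integral_const_mul]
    refine integral_congr_ae ?_
    filter_upwards [volume.ae_ne x] with z hz
    simp only [integral_const_mul]
    linear_combination f z * integral_riesz_kernel_mul hn hα hβ hαβn hz.symm
end

section
/- Let a > 0, l ∈ ℕ₀, n ∈ ℕ, and let f : ℝⁿ → ℂ be C^l with f(x) = O(|x|^{-a}). Let α ∈ ℂ with 0 < Re α < a and α ∉ n + 2ℕ₀, and let x₀ ∈ ℝⁿ. Let χ be a compactly supported C^∞ function with χ = 1 on a neighborhood of x₀, and write f₁ = (1-χ)f, f₂ = χf. Then: (i) I^α f₁ is C^∞ on a neighborhood of x₀; and (ii) I^α f₂ is C^l on ℝⁿ with ∂^p(I^α f₂) = I^α(∂^p f₂) for every multi-index p ∈ ℕ₀ⁿ with |p| ≤ l. -/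
open Complex MeasureTheory Filter Asymptotics Set Metric

/-- Partial derivative in the `i`-th coordinate direction. -/
noncomputable def pd (n : ℕ) (i : Fin n) (g : EuclideanSpace ℝ (Fin n) → ℂ) :
    EuclideanSpace ℝ (Fin n) → ℂ :=
  fun x => fderiv ℝ g x (EuclideanSpace.single i 1)

section ParametricIntegral

universe u

variable {E F : Type u} [NormedAddCommGroup E] [NormedSpace ℝ E]
  [NormedAddCommGroup F] [NormedSpace ℝ F] {Ω : Type*} [MeasurableSpace Ω] {μ : Measure Ω}

/-- The derivative of a parametric integral whose integrand is smooth in the parameter, with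
iterated derivatives dominated by integrable functions. -/
theorem hasFDerivAt_integral_of_iteratedFDeriv_le {V : Set E} (hV : IsOpen V) {K : E → Ω → F}
    (hK : ∀ ω, ContDiffOn ℝ (⊤ : ℕ∞) (K · ω) V)
    (hmeas : ∀ m : ℕ, ∀ x ∈ V,
      AEStronglyMeasurable (fun ω => iteratedFDeriv ℝ m (K · ω) x) μ)
    (hbound : ∀ m : ℕ, ∃ b : Ω → ℝ, Integrable b μ ∧
      ∀ ω, ∀ x ∈ V, ‖iteratedFDeriv ℝ m (K · ω) x‖ ≤ b ω) {x : E} (hx : x ∈ V) :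
    HasFDerivAt (fun x => ∫ ω, K x ω ∂μ) (∫ ω, fderiv ℝ (K · ω) x ∂μ) x := by
  have hmeas₀ : ∀ x ∈ V, AEStronglyMeasurable (K x) μ := fun x hx =>
    ((continuousMultilinearCurryFin0 ℝ E F).continuous.comp_aestronglyMeasurable
      (hmeas 0 x hx)).congr (.of_forall fun ω => by simp)
  obtain ⟨b₀, hb₀, hle₀⟩ := hbound 0
  obtain ⟨b₁, hb₁, hle₁⟩ := hbound 1
  have hmeas₁ : AEStronglyMeasurable (fun ω => fderiv ℝ (K · ω) x) μ := by
    have := (continuousMultilinearCurryFin1 ℝ E F).continuous.comp_aestronglyMeasurable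
      (hmeas 1 x hx)
    refine this.congr (.of_forall fun ω => ?_)
    ext v
    simp
  refine hasFDerivAt_integral_of_dominated_of_fderiv_le (hV.mem_nhds hx) ?_ ?_
    (F' := fun x ω => fderiv ℝ (K · ω) x) hmeas₁ (bound := b₁)
    (.of_forall fun ω y hy => ?_) hb₁ (.of_forall fun ω y hy => ?_)
  · filter_upwards [hV.mem_nhds hx] with y hy using hmeas₀ y hy
  · refine hb₀.mono' (hmeas₀ x hx) (.of_forall fun ω => ?_)
    simpa using hle₀ ω x hx
  · simpa using hle₁ ω y hy
  · exact (((hK ω).contDiffAt (hV.mem_nhds hy)).differentiableAt (by simp)).hasFDerivAt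

/-- A parametric integral is smooth if its integrand is smooth in the parameter, with iterated
derivatives dominated by integrable functions. -/
theorem contDiffOn_integral_of_iteratedFDeriv_le {V : Set E} (hV : IsOpen V) {K : E → Ω → F}
    (hK : ∀ ω, ContDiffOn ℝ (⊤ : ℕ∞) (K · ω) V)
    (hmeas : ∀ m : ℕ, ∀ x ∈ V,
      AEStronglyMeasurable (fun ω => iteratedFDeriv ℝ m (K · ω) x) μ)
    (hbound : ∀ m : ℕ, ∃ b : Ω → ℝ, Integrable b μ ∧
      ∀ ω, ∀ x ∈ V, ‖iteratedFDeriv ℝ m (K · ω) x‖ ≤ b ω) :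
    ContDiffOn ℝ (⊤ : ℕ∞) (fun x => ∫ ω, K x ω ∂μ) V := by
  refine contDiffOn_infty.2 fun N => ?_
  induction N generalizing F with
  | zero =>
    simp only [Nat.cast_zero, contDiffOn_zero]
    exact fun x hx => (hasFDerivAt_integral_of_iteratedFDeriv_le hV hK hmeas hbound
      hx).continuousAt.continuousWithinAt
  | succ N ih =>
    push_cast
    rw [contDiffOn_succ_iff_fderiv_of_isOpen hV]
    refine ⟨fun x hx => (hasFDerivAt_integral_of_iteratedFDeriv_le hV hK hmeas hbound
      hx).differentiableAt.differentiableWithinAt, by simp, ?_⟩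
    refine ContDiffOn.congr (f := fun x => ∫ ω, fderiv ℝ (K · ω) x ∂μ) ?_ fun x hx =>
      (hasFDerivAt_integral_of_iteratedFDeriv_le hV hK hmeas hbound hx).fderiv
    refine ih (K := fun x ω => fderiv ℝ (K · ω) x) (fun ω => ?_) (fun m x hx => ?_) fun m => ?_
    · exact ((contDiffOn_infty_iff_fderiv_of_isOpen hV).1 (hK ω)).2
    · have := (continuousMultilinearCurryRightEquiv' ℝ m E F).continuous.comp_aestronglyMeasurable
        (hmeas (m + 1) x hx)
      refine this.congr (.of_forall fun ω => ?_)
      simp [iteratedFDeriv_succ_eq_comp_right]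
    · obtain ⟨b, hb, hle⟩ := hbound (m + 1)
      exact ⟨b, hb, fun ω x hx => norm_iteratedFDeriv_fderiv.trans_le (hle ω x hx)⟩

end ParametricIntegral

section PowerKernel

variable {E : Type*} [NormedAddCommGroup E]

theorem norm_ofReal_norm_cpow {z : E} (hz : z ≠ 0) (β : ℂ) :
    ‖(‖z‖ : ℂ) ^ β‖ = ‖z‖ ^ β.re :=
  Complex.norm_cpow_eq_rpow_re_of_pos (norm_pos_iff.2 hz) β

variable [InnerProductSpace ℝ E]

theorem contDiffAt_ofReal_norm_cpow (β : ℂ) {z : E} (hz : z ≠ 0) :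
    ContDiffAt ℝ (⊤ : ℕ∞) (fun z : E => (‖z‖ : ℂ) ^ β) z := by
  have h : ContDiffAt ℝ (⊤ : ℕ∞) (fun z : E => cexp ((Real.log ‖z‖ : ℝ) * β)) z :=
    ((ofRealCLM.contDiff.contDiffAt.comp z
      ((contDiffAt_norm ℝ hz).log (norm_ne_zero_iff.2 hz))).mul contDiffAt_const).cexp
  refine h.congr_of_eventuallyEq ?_
  filter_upwards [isOpen_ne.mem_nhds hz] with y hy
  rw [Complex.cpow_def_of_ne_zero (by simpa using hy), Complex.ofReal_log (norm_nonneg y)]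

theorem norm_iteratedFDeriv_ofReal_norm_cpow_le [FiniteDimensional ℝ E] (β : ℂ) (m : ℕ) :
    ∃ C, 0 ≤ C ∧ ∀ z : E, z ≠ 0 →
      ‖iteratedFDeriv ℝ m (fun z : E => (‖z‖ : ℂ) ^ β) z‖ ≤ C * ‖z‖ ^ (β.re - m) := by
  set k : E → ℂ := fun z => (‖z‖ : ℂ) ^ β with hk
  have hcont : ContinuousOn (iteratedFDeriv ℝ m k) (sphere 0 1) := fun z hz =>
    ((contDiffAt_ofReal_norm_cpow β (ne_of_mem_sphere hz one_ne_zero)).continuousAt_iteratedFDeriv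
      (mod_cast le_top)).continuousWithinAt
  obtain ⟨C, hC⟩ := (isCompact_sphere (0 : E) 1).exists_bound_of_continuousOn hcont
  refine ⟨max C 0, le_max_right _ _, fun z hz => ?_⟩
  set t := ‖z‖ with ht
  have htpos : 0 < t := norm_pos_iff.2 hz
  let g : E ≃L[ℝ] E := ContinuousLinearEquiv.smulLeft (Units.mk0 t⁻¹ (inv_ne_zero htpos.ne'))
  have hg : ∀ y, g y = t⁻¹ • y := fun y => rfl
  have hgz : g z ∈ sphere (0 : E) 1 := by
    rw [hg, mem_sphere_zero_iff_norm, norm_smul, norm_inv, norm_norm, inv_mul_cancel₀ htpos.ne']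
  have hscale : k = fun y => ((t : ℂ) ^ β) • (k ∘ g) y := by
    funext y
    have hy : ‖y‖ = t * ‖g y‖ := by
      rw [hg, norm_smul, norm_inv, norm_norm, mul_inv_cancel_left₀ htpos.ne']
    simp only [hk, Function.comp_apply, smul_eq_mul]
    rw [hy, Complex.ofReal_mul, Complex.mul_cpow_ofReal_nonneg htpos.le (norm_nonneg _)]
  have hsmooth : ContDiffAt ℝ m (k ∘ g) z :=
    ((contDiffAt_ofReal_norm_cpow β (ne_of_mem_sphere hgz one_ne_zero)).of_le
      (mod_cast le_top)).comp z g.contDiff.contDiffAt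
  have hcomp : iteratedFDeriv ℝ m (k ∘ g) z =
      (iteratedFDeriv ℝ m k (g z)).compContinuousLinearMap fun _ => (g : E →L[ℝ] E) := by
    simpa only [preimage_univ, iteratedFDerivWithin_univ] using
      g.iteratedFDerivWithin_comp_right k uniqueDiffOn_univ (mem_univ (g z)) m
  have hgnorm : ‖(g : E →L[ℝ] E)‖ ≤ t⁻¹ := by
    refine ContinuousLinearMap.opNorm_le_bound _ (by positivity) fun y => ?_
    rw [ContinuousLinearEquiv.coe_coe, hg, norm_smul, norm_inv, norm_norm]
  calc
    ‖iteratedFDeriv ℝ m k z‖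
      = ‖(t : ℂ) ^ β‖ * ‖iteratedFDeriv ℝ m (k ∘ g) z‖ := by
        conv_lhs => rw [hscale, iteratedFDeriv_const_smul_apply' hsmooth, norm_smul]
    _ ≤ t ^ β.re * (max C 0 * t⁻¹ ^ m) := by
        rw [norm_ofReal_norm_cpow hz, hcomp]
        gcongr
        refine (ContinuousMultilinearMap.norm_compContinuousLinearMap_le _ _).trans ?_
        rw [Finset.prod_const, Finset.card_univ, Fintype.card_fin]
        gcongr
        exact (hC _ hgz).trans (le_max_left _ _)
    _ = max C 0 * t ^ (β.re - m) := by
        rw [Real.rpow_sub htpos, Real.rpow_natCast, inv_pow]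
        ring

end PowerKernel

section AwayFromSupport

theorem rpow_le_of_le_mul_of_le_mul {u w A : ℝ} (s : ℝ) (hu : 0 < u) (hw : 0 < w) (hA : 1 ≤ A)
    (huw : u ≤ A * w) (hwu : w ≤ A * u) : u ^ s ≤ A ^ |s| * w ^ s := by
  have hA0 : 0 < A := by linarith
  rcases le_total 0 s with hs | hs
  · rw [abs_of_nonneg hs, ← Real.mul_rpow hA0.le hw.le]
    exact Real.rpow_le_rpow hu.le huw hs
  · have h : (A * u) ^ s ≤ w ^ s := Real.rpow_le_rpow_of_nonpos hw hwu hs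
    rw [Real.mul_rpow hA0.le hu.le] at h
    rw [abs_of_nonpos hs, Real.rpow_neg hA0.le]
    rw [← div_eq_inv_mul, le_div_iff₀' (Real.rpow_pos_of_pos hA0 s)]
    exact h

variable {E : Type} [NormedAddCommGroup E]

/-- If `x` is within `r` of `x₀` and `y` is at distance at least `2 * r` from `x₀`, then `‖x - y‖`
is comparable to `1 + ‖y‖`. -/
theorem norm_sub_comparable_one_add_norm {x₀ : E} {r : ℝ} (hr : 0 < r) :
    ∃ A, 1 ≤ A ∧ ∀ x ∈ ball x₀ r, ∀ y ∉ ball x₀ (2 * r),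
      r ≤ ‖x - y‖ ∧ ‖x - y‖ ≤ A * (1 + ‖y‖) ∧ 1 + ‖y‖ ≤ A * ‖x - y‖ := by
  set B := 1 + ‖x₀‖ + r with hB
  have hB1 : 1 ≤ B := by have := norm_nonneg x₀; linarith
  have hBr : 0 < B / r := by positivity
  refine ⟨B + B / r, by linarith, fun x hx y hy => ?_⟩
  rw [mem_ball_iff_norm] at hx
  rw [mem_ball_iff_norm, not_lt] at hy
  have hxB : ‖x‖ ≤ ‖x₀‖ + r := by
    have := norm_add_le x₀ (x - x₀)
    rw [add_sub_cancel] at this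
    linarith
  have hrxy : r ≤ ‖x - y‖ := by
    have := norm_sub_le (x - x₀) (x - y)
    rw [sub_sub_sub_cancel_left] at this
    linarith
  refine ⟨hrxy, ?_, ?_⟩
  · have := norm_sub_le x y
    have hy0 := norm_nonneg y
    nlinarith [mul_nonneg hBr.le (by linarith : 0 ≤ 1 + ‖y‖)]
  · have h1 : ‖y‖ ≤ ‖x‖ + ‖x - y‖ := by
      simpa using norm_sub_le x (x - y)
    have h2 : B ≤ B / r * ‖x - y‖ := by
      rw [div_mul_eq_mul_div, le_div_iff₀ hr]
      gcongr
    nlinarith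

variable [InnerProductSpace ℝ E] [FiniteDimensional ℝ E] [MeasurableSpace E] [BorelSpace E]
  {μ : Measure E} [μ.IsAddHaarMeasure]

/-- The potential of a density is smooth away from the support of the density. -/
theorem contDiffOn_integral_mul_norm_cpow [Nontrivial E] {g : E → ℂ} (hg : Continuous g) {x₀ : E}
    {r : ℝ} (hr : 0 < r) (hg0 : ∀ y ∈ ball x₀ (2 * r), g y = 0) (β : ℂ)
    (hint : Integrable (fun y => ‖g y‖ * (1 + ‖y‖) ^ β.re) μ) :
    ContDiffOn ℝ (⊤ : ℕ∞) (fun x => ∫ y, g y * (‖x - y‖ : ℂ) ^ β ∂μ) (ball x₀ r) := by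
  set k : E → ℂ := fun z => (‖z‖ : ℂ) ^ β
  obtain ⟨A, hA1, hA⟩ := norm_sub_comparable_one_add_norm (x₀ := x₀) hr
  have hne : ∀ x ∈ ball x₀ r, ∀ y ∉ ball x₀ (2 * r), x - y ≠ 0 := fun x hx y hy =>
    norm_pos_iff.1 (hr.trans_le (hA x hx y hy).1)
  have hsmooth : ∀ x ∈ ball x₀ r, ∀ y ∉ ball x₀ (2 * r),
      ContDiffAt ℝ (⊤ : ℕ∞) (fun x => k (x - y)) x := fun x hx y hy =>
    (contDiffAt_ofReal_norm_cpow β (hne x hx y hy)).comp x (contDiffAt_id.sub contDiffAt_const)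
  have hderiv : ∀ m : ℕ, ∀ x ∈ ball x₀ r, ∀ y,
      iteratedFDeriv ℝ m (fun x => g y * k (x - y)) x = g y • iteratedFDeriv ℝ m k (x - y) := by
    intro m x hx y
    by_cases hy : y ∈ ball x₀ (2 * r)
    · simp [hg0 y hy]
    · simp_rw [← smul_eq_mul]
      rw [iteratedFDeriv_const_smul_apply' ((hsmooth x hx y hy).of_le (mod_cast le_top)),
        iteratedFDeriv_comp_sub]
  refine contDiffOn_integral_of_iteratedFDeriv_le isOpen_ball (fun y => ?_) (fun m x hx => ?_)
    fun m => ?_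
  · by_cases hy : y ∈ ball x₀ (2 * r)
    · simpa [hg0 y hy] using contDiffOn_const
    · exact fun x hx => (contDiffAt_const.mul (hsmooth x hx y hy)).contDiffWithinAt
  · rw [funext (hderiv m x hx)]
    have hcont : ContinuousOn (fun y => iteratedFDeriv ℝ m k (x - y)) {x}ᶜ := fun y hy =>
      (ContinuousAt.comp (f := fun y => x - y) (((contDiffAt_ofReal_norm_cpow β
        (sub_ne_zero.2 (Ne.symm hy))).continuousAt_iteratedFDeriv
        (mod_cast le_top))) (by fun_prop)).continuousWithinAt
    have := (hg.continuousOn.smul hcont).aestronglyMeasurable (μ := μ)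
      (measurableSet_singleton x).compl
    rwa [restrict_compl_singleton] at this
  · obtain ⟨C, hC0, hC⟩ := norm_iteratedFDeriv_ofReal_norm_cpow_le (E := E) β m
    refine ⟨_, hint.const_mul (C * (A ^ |β.re| * r ^ (-m : ℝ))), fun y x hx => ?_⟩
    rw [hderiv m x hx, norm_smul]
    by_cases hy : y ∈ ball x₀ (2 * r)
    · simp [hg0 y hy]
    obtain ⟨hrle, hle, hge⟩ := hA x hx y hy
    have hpos : 0 < ‖x - y‖ := hr.trans_le hrle
    calc
      ‖g y‖ * ‖iteratedFDeriv ℝ m k (x - y)‖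
        ≤ ‖g y‖ * (C * ((A ^ |β.re| * (1 + ‖y‖) ^ β.re) * r ^ (-m : ℝ))) := by
          gcongr
          refine (hC _ (hne x hx y hy)).trans ?_
          gcongr
          rw [sub_eq_add_neg β.re, Real.rpow_add hpos]
          gcongr ?_ * ?_
          · exact rpow_le_of_le_mul_of_le_mul _ hpos (by positivity) hA1 hle hge
          · exact Real.rpow_le_rpow_of_nonpos hr hrle (by simp)
      _ = _ := by ring

theorem integrable_norm_mul_one_add_norm_rpow {g : E → ℂ} (hg : Continuous g) {a s : ℝ}
    (ha : 0 ≤ a) (hdecay : g =O[cocompact E] fun y => ‖y‖ ^ (-a))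
    (hs : s - a < -Module.finrank ℝ E) :
    Integrable (fun y => ‖g y‖ * (1 + ‖y‖) ^ s) μ := by
  have hcont : Continuous fun y : E => ‖g y‖ * (1 + ‖y‖) ^ s :=
    hg.norm.mul ((continuous_const.add continuous_norm).rpow_const fun y =>
      .inl (by positivity : (0 : ℝ) < 1 + ‖y‖).ne')
  have hbig : (fun y : E => ‖y‖ ^ (-a)) =O[cocompact E] fun y => (1 + ‖y‖) ^ (-a) := by
    refine .of_bound ((2 : ℝ) ^ a) ?_
    filter_upwards [tendsto_norm_cocompact_atTop.eventually_ge_atTop 1] with y hy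
    rw [Real.norm_of_nonneg (by positivity), Real.norm_of_nonneg (by positivity)]
    have := rpow_le_of_le_mul_of_le_mul (-a) (by linarith : 0 < ‖y‖)
      (by linarith : 0 < 1 + ‖y‖) one_le_two (by linarith) (by linarith)
    rwa [abs_neg, abs_of_nonneg ha] at this
  refine hcont.locallyIntegrable.integrable_of_isBigO_cocompact
    ((hdecay.trans hbig).norm_left.mul (isBigO_refl (fun y : E => (1 + ‖y‖) ^ s) _)) ?_
  have h := integrable_one_add_norm (μ := μ) (E := E) (r := a - s) (by linarith)
  refine (h.congr (.of_forall fun y => ?_)).integrableAtFilter _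
  change (1 + ‖y‖) ^ (-(a - s)) = (1 + ‖y‖) ^ (-a) * (1 + ‖y‖) ^ s
  rw [← Real.rpow_add (by positivity)]
  ring_nf

end AwayFromSupport

section CompactSupport

variable {n : ℕ}

theorem locallyIntegrable_ofReal_norm_cpow {E : Type*} [NormedAddCommGroup E]
    [InnerProductSpace ℝ E] [FiniteDimensional ℝ E] [Nontrivial E] [MeasurableSpace E]
    [BorelSpace E] {μ : Measure E} [μ.IsAddHaarMeasure] {β : ℂ}
    (hβ : -Module.finrank ℝ E < β.re) :
    LocallyIntegrable (fun z : E => (‖z‖ : ℂ) ^ β) μ := by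
  have hdim : 1 ≤ Module.finrank ℝ E := Module.finrank_pos
  have hmeas : Measurable fun z : E => (‖z‖ : ℂ) ^ β := by fun_prop
  refine locallyIntegrable_of_norm_le_rpow (α := -β.re) (C := 1) hdim (by linarith) ?_
    hmeas.aestronglyMeasurable
  filter_upwards [Measure.ae_ne μ 0] with z hz
  rw [norm_ofReal_norm_cpow hz, neg_neg, one_mul]

theorem riesz_eq_smul_convolution (g : EuclideanSpace ℝ (Fin n) → ℂ) (α : ℂ) :
    riesz n g α = fun x => (Hfun n α)⁻¹ • convolution
      (fun z : EuclideanSpace ℝ (Fin n) => (‖z‖ : ℂ) ^ (α - n)) g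
      (ContinuousLinearMap.mul ℝ ℂ) volume x := by
  funext x
  rw [← convolution_flip, convolution_def, riesz, smul_eq_mul]
  simp

theorem locallyIntegrable_riesz_kernel (hn : 0 < n) {α : ℂ} (hα : 0 < α.re) :
    LocallyIntegrable (fun z : EuclideanSpace ℝ (Fin n) => (‖z‖ : ℂ) ^ (α - n)) := by
  have : NeZero n := ⟨hn.ne'⟩
  exact locallyIntegrable_ofReal_norm_cpow (by simpa using hα)

theorem contDiff_riesz (hn : 0 < n) {α : ℂ} (hα : 0 < α.re) {l : ℕ}
    {g : EuclideanSpace ℝ (Fin n) → ℂ} (hg : ContDiff ℝ l g) (hgc : HasCompactSupport g) :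
    ContDiff ℝ l (riesz n g α) := by
  rw [riesz_eq_smul_convolution]
  have h := hgc.contDiff_convolution_right (n := l) (ContinuousLinearMap.mul ℝ ℂ)
    (locallyIntegrable_riesz_kernel hn hα) hg
  exact h.const_smul _

theorem pd_riesz (hn : 0 < n) {α : ℂ} (hα : 0 < α.re) {g : EuclideanSpace ℝ (Fin n) → ℂ}
    (hg : ContDiff ℝ 1 g) (hgc : HasCompactSupport g) (i : Fin n) :
    pd n i (riesz n g α) = riesz n (pd n i g) α := by
  have hk := locallyIntegrable_riesz_kernel hn hα
  rw [riesz_eq_smul_convolution, riesz_eq_smul_convolution]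
  funext x
  have h := ((hgc.hasFDerivAt_convolution_right (ContinuousLinearMap.mul ℝ ℂ) hk hg
    x).fun_const_smul (Hfun n α)⁻¹).fderiv
  rw [pd, h, smul_apply, convolution_precompR_apply _ hk (hgc.fderiv ℝ)
    (hg.continuous_fderiv one_ne_zero)]
  rfl

theorem HasCompactSupport.pd {g : EuclideanSpace ℝ (Fin n) → ℂ} (hg : HasCompactSupport g)
    (i : Fin n) : HasCompactSupport (pd n i g) :=
  hg.fderiv_apply ℝ _

theorem ContDiff.pd {l : ℕ} {g : EuclideanSpace ℝ (Fin n) → ℂ} (hg : ContDiff ℝ (l + 1 : ℕ) g)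
    (i : Fin n) : ContDiff ℝ l (pd n i g) :=
  (hg.fderiv_right (by simp)).clm_apply contDiff_const

theorem HasCompactSupport.foldr_pd {g : EuclideanSpace ℝ (Fin n) → ℂ}
    (hg : HasCompactSupport g) (L : List (Fin n)) : HasCompactSupport (L.foldr (_root_.pd n) g) := by
  induction L with
  | nil => exact hg
  | cons i L ih => exact ih.pd i

theorem ContDiff.foldr_pd {g : EuclideanSpace ℝ (Fin n) → ℂ} (L : List (Fin n)) {l : ℕ}
    (hg : ContDiff ℝ (l + L.length : ℕ) g) : ContDiff ℝ l (L.foldr (_root_.pd n) g) := by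
  induction L generalizing l with
  | nil => exact hg
  | cons i L ih =>
    refine ContDiff.pd (ih ?_) i
    rwa [List.length_cons, ← add_assoc, add_right_comm] at hg

theorem foldr_pd_riesz (hn : 0 < n) {α : ℂ} (hα : 0 < α.re) {l : ℕ}
    {g : EuclideanSpace ℝ (Fin n) → ℂ} (hg : ContDiff ℝ l g) (hgc : HasCompactSupport g)
    (L : List (Fin n)) (hL : L.length ≤ l) :
    L.foldr (pd n) (riesz n g α) = riesz n (L.foldr (pd n) g) α := by
  induction L with
  | nil => rfl
  | cons i L ih =>
    rw [List.length_cons] at hL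
    rw [List.foldr_cons, List.foldr_cons, ih (by lia)]
    have hg' : ContDiff ℝ (1 + L.length : ℕ) g := hg.of_le (by exact_mod_cast (by lia))
    exact pd_riesz hn hα (by simpa using hg'.foldr_pd L) (hgc.foldr_pd L) i

end CompactSupport

theorem stmt_8 (a : ℝ) (ha : 0 < a) (l : ℕ) (n : ℕ) (hn : 0 < n)
    (f : EuclideanSpace ℝ (Fin n) → ℂ) (hf : ContDiff ℝ l f)
    (hdecay : f =O[cocompact (EuclideanSpace ℝ (Fin n))] fun y => ‖y‖ ^ (-a))
    (α : ℂ) (hα0 : 0 < α.re) (hα1 : α.re < a)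
    (hαpole : ∀ m : ℕ, α ≠ (n : ℂ) + 2 * m)
    (x₀ : EuclideanSpace ℝ (Fin n))
    (χ : EuclideanSpace ℝ (Fin n) → ℝ) (hχ : ContDiff ℝ (⊤ : ℕ∞) χ)
    (hχc : HasCompactSupport χ)
    (U : Set (EuclideanSpace ℝ (Fin n))) (hU : IsOpen U) (hx₀U : x₀ ∈ U)
    (hχ1 : ∀ y ∈ U, χ y = 1)
    (f₁ f₂ : EuclideanSpace ℝ (Fin n) → ℂ)
    (hf₁ : f₁ = fun y => (1 - χ y) • f y) (hf₂ : f₂ = fun y => χ y • f y) :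
    (∃ V : Set (EuclideanSpace ℝ (Fin n)), IsOpen V ∧ x₀ ∈ V ∧
      ContDiffOn ℝ (⊤ : ℕ∞) (riesz n f₁ α) V) ∧
    ContDiff ℝ l (riesz n f₂ α) ∧
    ∀ L : List (Fin n), L.length ≤ l →
      L.foldr (pd n) (riesz n f₂ α) = riesz n (L.foldr (pd n) f₂) α := by
  subst hf₁ hf₂
  have : NeZero n := ⟨hn.ne'⟩
  have hχl : ContDiff ℝ l χ := hχ.of_le (mod_cast le_top)
  have hf₂c : HasCompactSupport fun y => χ y • f y := hχc.smul_right
  have hf₂l : ContDiff ℝ l fun y => χ y • f y := hχl.smul hf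
  refine ⟨?_, contDiff_riesz hn hα0 hf₂l hf₂c, fun L hL => foldr_pd_riesz hn hα0 hf₂l hf₂c L hL⟩
  obtain ⟨ε, hε, hball⟩ := Metric.isOpen_iff.1 hU x₀ hx₀U
  have hcont : Continuous fun y => (1 - χ y) • f y :=
    (continuous_const.sub hχ.continuous).smul hf.continuous
  have hdecay₁ : (fun y => (1 - χ y) • f y) =O[cocompact (EuclideanSpace ℝ (Fin n))]
      fun y => ‖y‖ ^ (-a) := by
    refine hdecay.congr' ?_ .rfl
    filter_upwards [hχc.compl_mem_cocompact] with y hy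
    rw [image_eq_zero_of_notMem_tsupport hy, sub_zero, one_smul]
  have hint : Integrable fun y => ‖(1 - χ y) • f y‖ * (1 + ‖y‖) ^ (α - n).re :=
    integrable_norm_mul_one_add_norm_rpow hcont ha.le hdecay₁
      (by simp only [sub_re, natCast_re, finrank_euclideanSpace_fin]; linarith)
  refine ⟨ball x₀ (ε / 2), isOpen_ball, mem_ball_self (by positivity), ?_⟩
  refine contDiffOn_const.mul (contDiffOn_integral_mul_norm_cpow hcont (by positivity)
    (fun y hy => ?_) (α - n) hint)
  rw [mul_div_cancel₀ ε two_ne_zero] at hy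
  rw [hχ1 y (hball hy), sub_self, zero_smul]
end

section
/- Let a > 1, l ∈ ℕ₀, 0 < ε < 1, n ∈ ℕ, x ∈ ℝⁿ, and let f : ℝⁿ → ℂ be continuous with f(x) = O(|x|^{-a}). Let α ∈ ℂ with Re α = 1 and α ∉ n + 2ℕ₀. If f is C^l on a neighborhood of x with every l-th order partial derivative Hölder continuous of index ε there, then for every ε' with 0 < ε' < ε, I^α f is C^{l+1} on a neighborhood of x with every (l+1)-th order partial derivative Hölder continuous of index ε' there. -/
open Complex MeasureTheory Filter Asymptotics Set Metric

theorem continuousOn_of_holder {E F : Type*} [NormedAddCommGroup E] [NormedAddCommGroup F]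
    {ε : ℝ} {h : E → F} {V : Set E} (hε : 0 < ε)
    (hM : ∃ M : ℝ, ∀ x ∈ V, ∀ y ∈ V, ‖h x - h y‖ ≤ M * ‖x - y‖ ^ ε) : ContinuousOn h V := by
  obtain ⟨M, hM⟩ := hM
  intro x hx
  rw [ContinuousWithinAt, tendsto_iff_norm_sub_tendsto_zero]
  refine squeeze_zero' (.of_forall fun _ => norm_nonneg _)
    (eventually_mem_nhdsWithin.mono fun y hy => hM y hy x hx) ?_
  have : Continuous fun y : E => M * ‖y - x‖ ^ ε := by
    refine continuous_const.mul (Continuous.rpow_const (by fun_prop) fun _ => Or.inr hε.le)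
  have h2 := (this.tendsto x).mono_left (nhdsWithin_le_nhds (s := V))
  simpa [Real.zero_rpow hε.ne'] using h2

/-- `f` is `C^l` on `V` and its `l`-th derivative is Hölder continuous of index `ε` there. -/
def HolderDerivOn {E F : Type*} [NormedAddCommGroup E] [NormedSpace ℝ E] [NormedAddCommGroup F]
    [NormedSpace ℝ F] (l : ℕ) (ε : ℝ) (f : E → F) (V : Set E) : Prop :=
  ContDiffOn ℝ l f V ∧ ∃ M : ℝ, ∀ x ∈ V, ∀ y ∈ V,
    ‖iteratedFDeriv ℝ l f x - iteratedFDeriv ℝ l f y‖ ≤ M * ‖x - y‖ ^ ε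

namespace HolderDerivOn

variable {E F : Type*} [NormedAddCommGroup E] [NormedSpace ℝ E] [NormedAddCommGroup F]
  [NormedSpace ℝ F] {l : ℕ} {ε : ℝ} {f g : E → F} {V W : Set E}

theorem mono (hf : HolderDerivOn l ε f V) (h : W ⊆ V) : HolderDerivOn l ε f W :=
  ⟨hf.1.mono h, hf.2.imp fun _ hM x hx y hy => hM x (h hx) y (h hy)⟩

theorem congr (hV : IsOpen V) (hf : HolderDerivOn l ε f V) (h : EqOn g f V) :
    HolderDerivOn l ε g V := by
  refine ⟨hf.1.congr h, hf.2.imp fun M hM x hx y hy => ?_⟩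
  have key : ∀ z ∈ V, iteratedFDeriv ℝ l g z = iteratedFDeriv ℝ l f z := fun z hz =>
    ((h.eventuallyEq_of_mem (hV.mem_nhds hz)).iteratedFDeriv ℝ l).eq_of_nhds
  rw [key x hx, key y hy]
  exact hM x hx y hy

theorem add (hV : IsOpen V) (hf : HolderDerivOn l ε f V) (hg : HolderDerivOn l ε g V) :
    HolderDerivOn l ε (f + g) V := by
  obtain ⟨M, hM⟩ := hf.2
  obtain ⟨N, hN⟩ := hg.2
  refine ⟨hf.1.add hg.1, M + N, fun x hx y hy => ?_⟩
  have key : ∀ z ∈ V, iteratedFDeriv ℝ l (f + g) z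
      = iteratedFDeriv ℝ l f z + iteratedFDeriv ℝ l g z := fun z hz =>
    iteratedFDeriv_add_apply (hf.1.contDiffAt (hV.mem_nhds hz)) (hg.1.contDiffAt (hV.mem_nhds hz))
  rw [key x hx, key y hy, add_sub_add_comm, add_mul]
  exact (norm_add_le _ _).trans (add_le_add (hM x hx y hy) (hN x hx y hy))

theorem const_smul {F : Type*} [NormedAddCommGroup F] [NormedSpace ℝ F] [NormedSpace ℂ F]
    [IsScalarTower ℝ ℂ F] {f : E → F} (c : ℂ) (hV : IsOpen V) (hf : HolderDerivOn l ε f V) :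
    HolderDerivOn l ε (c • f) V := by
  obtain ⟨M, hM⟩ := hf.2
  refine ⟨hf.1.const_smul c, ‖c‖ * M, fun x hx y hy => ?_⟩
  have key : ∀ z ∈ V, iteratedFDeriv ℝ l (c • f) z = c • iteratedFDeriv ℝ l f z := fun z hz =>
    iteratedFDeriv_const_smul_apply (hf.1.contDiffAt (hV.mem_nhds hz))
  rw [key x hx, key y hy, ← smul_sub, norm_smul, mul_assoc]
  exact mul_le_mul_of_nonneg_left (hM x hx y hy) (norm_nonneg c)

theorem norm_iteratedFDeriv_succ_sub (f : E → F) (l : ℕ) (x y : E) :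
    ‖iteratedFDeriv ℝ (l + 1) f x - iteratedFDeriv ℝ (l + 1) f y‖
      = ‖iteratedFDeriv ℝ l (fderiv ℝ f) x - iteratedFDeriv ℝ l (fderiv ℝ f) y‖ := by
  rw [iteratedFDeriv_succ_eq_comp_right, iteratedFDeriv_succ_eq_comp_right, ← dist_eq_norm,
    ← dist_eq_norm]
  exact (continuousMultilinearCurryRightEquiv' ℝ l E F).symm.isometry.dist_eq _ _

theorem succ_iff (hV : IsOpen V) : HolderDerivOn (l + 1) ε f V ↔
    DifferentiableOn ℝ f V ∧ HolderDerivOn l ε (fderiv ℝ f) V := by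
  simp only [HolderDerivOn, norm_iteratedFDeriv_succ_sub, Nat.cast_succ,
    contDiffOn_succ_iff_fderiv_of_isOpen hV]
  simp [and_assoc]

theorem zero_iff : HolderDerivOn 0 ε f V ↔ ContinuousOn f V ∧
    ∃ M : ℝ, ∀ x ∈ V, ∀ y ∈ V, ‖f x - f y‖ ≤ M * ‖x - y‖ ^ ε := by
  simp only [HolderDerivOn, iteratedFDeriv_zero_eq_comp, Function.comp_apply, ← map_sub,
    LinearIsometryEquiv.norm_map, Nat.cast_zero, contDiffOn_zero]

theorem exists_of_contDiff (hε : 0 < ε) (hε1 : ε < 1) (hf : ContDiff ℝ (l + 1) f) (x : E) :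
    ∃ r > 0, HolderDerivOn l ε f (ball x r) := by
  have h1 : ContDiff ℝ 1 (iteratedFDeriv ℝ l f) :=
    hf.iteratedFDeriv_right (by rw [add_comm])
  obtain ⟨K, t, ht, hK⟩ := h1.contDiffAt.exists_lipschitzOnWith (x := x)
  obtain ⟨r, hr, hrt⟩ := Metric.mem_nhds_iff.1 ht
  refine ⟨min r (1 / 2), by positivity, (hf.of_le (by simp)).contDiffOn, K, fun y hy z hz => ?_⟩
  have hy' := mem_ball.1 hy
  have hz' := mem_ball.1 hz
  have hyz : ‖y - z‖ ≤ 1 := by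
    rw [← dist_eq_norm]
    have := dist_triangle_right y z x
    have := min_le_right r (1 / 2)
    linarith
  have h2 := hK.norm_sub_le (hrt (ball_subset_ball (min_le_left _ _) hy))
    (hrt (ball_subset_ball (min_le_left _ _) hz))
  refine h2.trans (mul_le_mul_of_nonneg_left ?_ K.2)
  simpa using Real.rpow_le_rpow_of_exponent_ge' (norm_nonneg (y - z)) hyz hε.le hε1.le

end HolderDerivOn

open ContinuousLinearMap in
/-- Differences of integrals against the derivative of a compactly supported kernel. -/
theorem norm_integral_fderiv_sub_le {E F : Type*} [NormedAddCommGroup E] [NormedSpace ℝ E]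
    [FiniteDimensional ℝ E] [MeasureSpace E] [BorelSpace E]
    [IsFiniteMeasureOnCompacts (volume : Measure E)]
    [NormedAddCommGroup F] [NormedSpace ℝ F] [NormedSpace ℂ F] [IsScalarTower ℝ ℂ F]
    {K : E → ℂ} (hK : ContDiff ℝ 1 K) {δ : ℝ} (hδ : Function.support K ⊆ closedBall 0 δ)
    {h₁ h₂ : E → F} (hc₁ : Continuous h₁) (hc₂ : Continuous h₂) {S : ℝ}
    (hS : ∀ z, ‖z‖ ≤ δ → ‖h₁ z - h₂ z‖ ≤ S) :
    ‖(∫ z, (lsmul ℝ ℂ).precompL E (fderiv ℝ K z) (h₁ z))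
      - ∫ z, (lsmul ℝ ℂ).precompL E (fderiv ℝ K z) (h₂ z)‖ ≤ (∫ z, ‖fderiv ℝ K z‖) * S := by
  have hcs : HasCompactSupport K :=
    HasCompactSupport.of_support_subset_isCompact (isCompact_closedBall 0 δ) hδ
  have hDc : Continuous (fderiv ℝ K) := hK.continuous_fderiv one_ne_zero
  have hDs : HasCompactSupport (fderiv ℝ K) := hcs.fderiv ℝ
  have hint : ∀ h : E → F, Continuous h →
      Integrable fun z => (lsmul ℝ ℂ).precompL E (fderiv ℝ K z) (h z) := fun h hh => by
    refine Continuous.integrable_of_hasCompactSupport (by fun_prop) (hDs.mono fun z hz => ?_)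
    contrapose! hz
    rw [Function.notMem_support] at hz ⊢
    simp [hz]
  rw [← integral_sub (hint _ hc₁) (hint _ hc₂), ← integral_mul_const]
  refine norm_integral_le_of_norm_le
    ((hDc.integrable_of_hasCompactSupport hDs).norm.mul_const S) (.of_forall fun z => ?_)
  rw [← map_sub]
  by_cases hz : fderiv ℝ K z = 0
  · simp [hz]
  have hz' : ‖z‖ ≤ δ := by
    have := (support_fderiv_subset ℝ (f := K)) hz
    simpa using closure_minimal hδ isClosed_closedBall this
  refine (opNorm_le_bound _ (by positivity) fun v => ?_).trans
    (mul_le_mul_of_nonneg_left (hS z hz') (norm_nonneg _))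
  rw [precompL_apply, lsmul_apply, norm_smul, mul_right_comm]
  exact mul_le_mul_of_nonneg_right (le_opNorm _ _) (norm_nonneg _)

open ContinuousLinearMap in
theorem integral_fderiv_eq_zero_of_hasCompactSupport {E F : Type*} [NormedAddCommGroup E]
    [NormedSpace ℝ E] [FiniteDimensional ℝ E] [MeasureSpace E] [BorelSpace E]
    [(volume : Measure E).IsAddHaarMeasure]
    [NormedAddCommGroup F] [NormedSpace ℝ F] [NormedSpace ℂ F] [IsScalarTower ℝ ℂ F]
    {K : E → ℂ} (hK : ContDiff ℝ 1 K) (hcs : HasCompactSupport K) (y : F) :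
    ∫ z, (lsmul ℝ ℂ).precompL E (fderiv ℝ K z) y = 0 := by
  have h := hcs.hasFDerivAt_convolution_left (μ := volume) (lsmul ℝ ℂ) hK
    (locallyIntegrable_const y) 0
  exact h.unique (hasFDerivAt_const _ _)

theorem fderiv_dilate {E : Type*} [NormedAddCommGroup E] [NormedSpace ℝ E] {φ : E → ℂ}
    (hφ : Differentiable ℝ φ) (b : ℂ) (t : ℝ) (z : E) :
    fderiv ℝ (fun z => b * φ (t • z)) z = b • t • fderiv ℝ φ (t • z) := by
  rw [fderiv_const_mul (by fun_prop), fderiv_comp_smul]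

theorem hasCompactSupport_dyadic {E : Type*} [NormedAddCommGroup E]
    [NormedSpace ℝ E] {φ : E → ℂ} {c : ℂ} (hφs : HasCompactSupport φ) (j : ℕ) :
    HasCompactSupport fun z => c ^ j * φ ((2 : ℝ) ^ j • z) :=
  (hφs.comp_smul (by positivity)).mul_left

theorem integrable_dyadic {E : Type*} [NormedAddCommGroup E] [NormedSpace ℝ E]
    [MeasureSpace E] [BorelSpace E] [IsFiniteMeasureOnCompacts (volume : Measure E)]
    {φ : E → ℂ} {c : ℂ} (hφ : Continuous φ) (hφs : HasCompactSupport φ) (j : ℕ) :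
    Integrable fun z => c ^ j * φ ((2 : ℝ) ^ j • z) :=
  Continuous.integrable_of_hasCompactSupport (by fun_prop) (hasCompactSupport_dyadic hφs j)

section Dyadic

variable {E : Type*} [NormedAddCommGroup E] [NormedSpace ℝ E] [FiniteDimensional ℝ E]
  [MeasureSpace E] [BorelSpace E] [(volume : Measure E).IsAddHaarMeasure]
  {φ : E → ℂ} {c : ℂ}

theorem integral_norm_fderiv_dyadic (hφ : ContDiff ℝ 1 φ)
    (hc : ‖c‖ * 2 = 2 ^ Module.finrank ℝ E) (j : ℕ) :
    ∫ z, ‖fderiv ℝ (fun z => c ^ j * φ ((2 : ℝ) ^ j • z)) z‖ = ∫ z, ‖fderiv ℝ φ z‖ := by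
  simp_rw [fderiv_dilate (hφ.differentiable one_ne_zero), norm_smul]
  rw [integral_const_mul, integral_const_mul,
    Measure.integral_comp_smul volume (fun z => ‖fderiv ℝ φ z‖), smul_eq_mul, ← mul_assoc,
    ← mul_assoc]
  have : ‖c ^ j‖ * ‖(2 : ℝ) ^ j‖ = ((2 : ℝ) ^ j) ^ Module.finrank ℝ E := by
    rw [norm_pow, norm_pow, Real.norm_two, ← mul_pow, hc, ← pow_mul, ← pow_mul, mul_comm]
  rw [this, abs_of_nonneg (by positivity), mul_inv_cancel₀ (by positivity), one_mul]

theorem integral_norm_dyadic (hc : ‖c‖ * 2 = 2 ^ Module.finrank ℝ E) (j : ℕ) :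
    ∫ z, ‖c ^ j * φ ((2 : ℝ) ^ j • z)‖ = (1 / 2) ^ j * ∫ z, ‖φ z‖ := by
  simp_rw [norm_mul]
  rw [integral_const_mul, Measure.integral_comp_smul volume (fun z => ‖φ z‖), smul_eq_mul,
    ← mul_assoc]
  have : ‖c ^ j‖ = (1 / 2) ^ j * ((2 : ℝ) ^ j) ^ Module.finrank ℝ E := by
    rw [norm_pow, ← pow_mul, mul_comm j, pow_mul, ← hc, mul_pow]
    rw [one_div, inv_pow, mul_comm (‖c‖ ^ j), inv_mul_cancel_left₀ (by positivity)]
  rw [this, abs_of_nonneg (by positivity), mul_inv_cancel_right₀ (by positivity)]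

theorem integrable_of_hasSum_dyadic (hφ : Continuous φ) (hφs : HasCompactSupport φ)
    (hc : ‖c‖ * 2 = 2 ^ Module.finrank ℝ E) {K : E → ℂ}
    (hK : ∀ z, HasSum (fun j : ℕ => c ^ j * φ ((2 : ℝ) ^ j • z)) (K z)) : Integrable K := by
  have hint := integrable_dyadic (c := c) hφ hφs
  have hmeas : AEStronglyMeasurable K :=
    aestronglyMeasurable_of_tendsto_ae atTop
      (fun N => Finset.aestronglyMeasurable_fun_sum (Finset.range N) fun j _ =>
        (hint j).aestronglyMeasurable)
      (.of_forall fun z => (hK z).tendsto_sum_nat)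
  refine ⟨hmeas, ?_⟩
  rw [hasFiniteIntegral_iff_enorm]
  calc ∫⁻ z, ‖K z‖ₑ ≤ ∫⁻ z, ∑' j : ℕ, ‖c ^ j * φ ((2 : ℝ) ^ j • z)‖ₑ :=
        lintegral_mono fun z => by rw [← (hK z).tsum_eq]; exact enorm_tsum_le_tsum_enorm
    _ = ∑' j : ℕ, ∫⁻ z, ‖c ^ j * φ ((2 : ℝ) ^ j • z)‖ₑ :=
        lintegral_tsum fun j => (hint j).aestronglyMeasurable.enorm
    _ = ∑' j : ℕ, ENNReal.ofReal ((1 / 2) ^ j * ∫ z, ‖φ z‖) := by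
        congr with j
        rw [← integral_norm_dyadic hc, ofReal_integral_norm_eq_lintegral_enorm (hint j)]
    _ < ⊤ := by
        have : Summable fun j : ℕ => (1 / 2 : ℝ) ^ j * ∫ z, ‖φ z‖ :=
          summable_geometric_two.mul_right _
        exact this.tsum_ofReal_lt_top

end Dyadic

theorem le_mul_rpow_of_le_of_le {d B u v θ : ℝ} (hd : 0 ≤ d) (hB : 0 ≤ B) (hu : 0 ≤ u)
    (hv : 0 ≤ v) (hθ0 : 0 < θ) (hθ1 : θ < 1) (h1 : d ≤ B * u) (h2 : d ≤ B * v) :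
    d ≤ B * u ^ (1 - θ) * v ^ θ := by
  have hsplit : ∀ y : ℝ, 0 ≤ y → y = y ^ (1 - θ) * y ^ θ := fun y hy => by
    rw [← Real.rpow_add_of_nonneg hy (by linarith) hθ0.le, sub_add_cancel, Real.rpow_one]
  calc d = d ^ (1 - θ) * d ^ θ := hsplit d hd
    _ ≤ (B * u) ^ (1 - θ) * (B * v) ^ θ := by gcongr
    _ = (B ^ (1 - θ) * B ^ θ) * u ^ (1 - θ) * v ^ θ := by
        rw [Real.mul_rpow hB hu, Real.mul_rpow hB hv]; ring
    _ = B * u ^ (1 - θ) * v ^ θ := by rw [← hsplit B hB]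

open ContinuousLinearMap in
/-- Convolution with a dyadic sum of rescaled bumps, of order one, gains one derivative in Hölder
classes, up to an arbitrarily small loss of the index. -/
theorem holderDerivOn_one_convolution {E : Type*} [NormedAddCommGroup E] [NormedSpace ℝ E]
    [FiniteDimensional ℝ E] [MeasureSpace E] [BorelSpace E] [(volume : Measure E).IsAddHaarMeasure]
    {F : Type*} [NormedAddCommGroup F] [NormedSpace ℝ F] [NormedSpace ℂ F] [IsScalarTower ℝ ℂ F]
    [CompleteSpace F] {φ K : E → ℂ} {c : ℂ} {ρ r R ε ε' M : ℝ} {g : E → F} {x : E}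
    (hφ : ContDiff ℝ 1 φ) (hφρ : Function.support φ ⊆ closedBall 0 ρ)
    (hc : ‖c‖ * 2 = 2 ^ Module.finrank ℝ E)
    (hK : ∀ z, HasSum (fun j : ℕ => c ^ j * φ ((2 : ℝ) ^ j • z)) (K z))
    (hρ : 0 < ρ) (hr : 0 < r) (hR : r + ρ < R) (hε' : 0 < ε') (hεε : ε' < ε)
    (hg : Continuous g) (hgs : HasCompactSupport g)
    (hM : ∀ u ∈ ball x R, ∀ v ∈ ball x R, ‖g u - g v‖ ≤ M * ‖u - v‖ ^ ε) :
    HolderDerivOn 1 ε' (convolution K g (lsmul ℝ ℂ) volume) (ball x r) := by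
  wlog hM0 : 0 ≤ M generalizing M
  · exact this (M := |M|) (fun u hu v hv => (hM u hu v hv).trans (by gcongr; exact le_abs_self M))
      (abs_nonneg M)
  have hε : 0 < ε := hε'.trans hεε
  have hφs : HasCompactSupport φ :=
    HasCompactSupport.of_support_subset_isCompact (isCompact_closedBall 0 ρ) hφρ
  set k : ℕ → E → ℂ := fun j z => c ^ j * φ ((2 : ℝ) ^ j • z) with hk
  have hkC : ∀ j, ContDiff ℝ 1 (k j) := fun j => by fun_prop
  have hkS : ∀ j, HasCompactSupport (k j) := hasCompactSupport_dyadic hφs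
  have hkδ : ∀ j, Function.support (k j) ⊆ closedBall 0 (ρ / 2 ^ j) := fun j z hz => by
    have h1 : (2 : ℝ) ^ j • z ∈ Function.support φ := fun h => hz (by simp [hk, h])
    have h2 := hφρ h1
    rw [mem_closedBall_zero_iff, norm_smul, norm_pow, Real.norm_two] at h2
    rw [mem_closedBall_zero_iff, le_div_iff₀' (by positivity)]
    exact h2
  have hkδ' : ∀ j, ρ / 2 ^ j ≤ ρ := fun j => div_le_self hρ.le (one_le_pow₀ one_le_two)
  set A : ℝ := ∫ z, ‖fderiv ℝ φ z‖ with hA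
  have hA0 : 0 ≤ A := integral_nonneg fun _ => norm_nonneg _
  have hkA : ∀ j, ∫ z, ‖fderiv ℝ (k j) z‖ = A := integral_norm_fderiv_dyadic hφ hc
  set D : ℕ → E → E →L[ℝ] F := fun j w => ∫ z, (lsmul ℝ ℂ).precompL E (fderiv ℝ (k j) z) (g (w - z))
    with hD
  set T : ℕ → E → F := fun j => convolution (k j) g (lsmul ℝ ℂ) volume with hT
  have hTD : ∀ j w, HasFDerivAt (T j) (D j w) w := fun j w =>
    (hkS j).hasFDerivAt_convolution_left (lsmul ℝ ℂ) (hkC j) hg.locallyIntegrable w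
  have hball : ∀ w ∈ ball x r, ∀ z : E, ‖z‖ ≤ ρ → w - z ∈ ball x R := fun w hw z hz => by
    rw [mem_ball_iff_norm] at hw ⊢
    calc ‖w - z - x‖ = ‖(w - x) - z‖ := by congr 1; abel
      _ ≤ ‖w - x‖ + ‖z‖ := norm_sub_le _ _
      _ < R := by linarith
  have hD1 : ∀ j, ∀ w ∈ ball x r, ‖D j w‖ ≤ A * (M * (ρ / 2 ^ j) ^ ε) := fun j w hw => by
    have h := norm_integral_fderiv_sub_le (hkC j) (hkδ j) (h₁ := fun z => g (w - z))
      (h₂ := fun _ => g w) (by fun_prop) continuous_const (S := M * (ρ / 2 ^ j) ^ ε)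
      (fun z hz => by
        have h0 := hM _ (hball w hw z (hz.trans (hkδ' j))) w
          (by simpa using hball w hw 0 (by simpa using hρ.le))
        refine h0.trans ?_
        rw [sub_sub_cancel_left, norm_neg]
        gcongr)
    rwa [integral_fderiv_eq_zero_of_hasCompactSupport (hkC j) (hkS j), sub_zero, hkA] at h
  have hD2 : ∀ j, ∀ w ∈ ball x r, ∀ w' ∈ ball x r, ‖D j w - D j w'‖ ≤ A * (M * ‖w - w'‖ ^ ε) :=
    fun j w hw w' hw' => by
    have h := norm_integral_fderiv_sub_le (hkC j) (hkδ j) (h₁ := fun z => g (w - z))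
      (h₂ := fun z => g (w' - z)) (by fun_prop) (by fun_prop) (S := M * ‖w - w'‖ ^ ε)
      (fun z hz => by
        have h0 := hM _ (hball w hw z (hz.trans (hkδ' j))) _ (hball w' hw' z (hz.trans (hkδ' j)))
        rwa [sub_sub_sub_cancel_right] at h0)
    rwa [hkA] at h
  have hρj : ∀ j : ℕ, (ρ / 2 ^ j) ^ ε = ρ ^ ε * ((1 / 2) ^ ε) ^ j := fun j => by
    rw [← Real.rpow_mul_natCast (by norm_num), mul_comm ε, Real.rpow_natCast_mul (by norm_num),
      ← Real.mul_rpow hρ.le (by positivity), one_div, inv_pow, div_eq_mul_inv]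
  have hq0 : 0 < (1 / 2 : ℝ) ^ ε := by positivity
  have hq1 : (1 / 2 : ℝ) ^ ε < 1 := Real.rpow_lt_one (by norm_num) (by norm_num) hε
  set q : ℝ := (1 / 2 : ℝ) ^ ε with hq
  have hsum1 : Summable fun j : ℕ => A * (M * (ρ / 2 ^ j) ^ ε) := by
    simp_rw [hρj]
    exact (((summable_geometric_of_lt_one hq0.le hq1).mul_left _).mul_left _).mul_left _
  have hTsum : ∀ w, HasSum (fun j => T j w) (convolution K g (lsmul ℝ ℂ) volume w) := fun w => by
    obtain ⟨G, hG⟩ := hgs.exists_bound_of_continuous hg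
    have hint : ∀ j, Integrable fun z => k j z • g (w - z) := fun j =>
      Continuous.integrable_of_hasCompactSupport (by fun_prop) (hkS j).smul_right
    have h := hasSum_integral_of_summable_integral_norm hint (by
      refine Summable.of_nonneg_of_le (fun j => integral_nonneg fun _ => norm_nonneg _)
        (fun j => ?_) ((summable_geometric_two.mul_right (∫ z, ‖φ z‖)).mul_right G)
      rw [← integral_norm_dyadic hc, ← integral_mul_const]
      refine integral_mono (hint j).norm
        ((integrable_dyadic hφ.continuous hφs j).norm.mul_const G) fun z => ?_
      simp only [norm_smul, hk]
      exact mul_le_mul_of_nonneg_left (hG _) (norm_nonneg _))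
    have he : ∀ z, ∑' j, k j z • g (w - z) = K z • g (w - z) := fun z =>
      ((hK z).smul_const (g (w - z))).tsum_eq
    simp_rw [he] at h
    exact h
  have hTfun : convolution K g (lsmul ℝ ℂ) volume = fun w => ∑' j, T j w :=
    funext fun w => (hTsum w).tsum_eq.symm
  have hderiv : ∀ w ∈ ball x r,
      HasFDerivAt (convolution K g (lsmul ℝ ℂ) volume) (∑' j, D j w) w := fun w hw => by
    rw [hTfun]
    exact hasFDerivAt_tsum_of_isPreconnected hsum1 isOpen_ball (convex_ball x r).isPreconnected
      (fun j w _ => hTD j w) hD1 (mem_ball_self hr) (hTsum x).summable hw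
  set θ : ℝ := ε' / ε with hθ
  have hθ0 : 0 < θ := by positivity
  have hθ1 : θ < 1 := (div_lt_one hε).2 hεε
  set B : ℝ := A * M * (2 * ρ ^ ε + 1) with hB
  have hB0 : 0 ≤ B := by positivity
  have hq'1 : q ^ (1 - θ) < 1 := Real.rpow_lt_one hq0.le hq1 (by linarith)
  have hqsum : Summable fun j : ℕ => (q ^ (1 - θ)) ^ j :=
    summable_geometric_of_lt_one (by positivity) hq'1
  have hD3 : ∀ j, ∀ w ∈ ball x r, ∀ w' ∈ ball x r,
      ‖D j w - D j w'‖ ≤ B * (q ^ (1 - θ)) ^ j * ‖w - w'‖ ^ ε' := fun j w hw w' hw' => by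
    have h1 : ‖D j w - D j w'‖ ≤ B * q ^ j := by
      refine (norm_sub_le _ _).trans ((add_le_add (hD1 j w hw) (hD1 j w' hw')).trans ?_)
      rw [hρj, hB]
      have : 0 ≤ A * M * q ^ j := by positivity
      linarith
    have h2 : ‖D j w - D j w'‖ ≤ B * ‖w - w'‖ ^ ε := by
      refine (hD2 j w hw w' hw').trans ?_
      rw [hB]
      have : 0 ≤ A * M * ‖w - w'‖ ^ ε * (2 * ρ ^ ε) := by positivity
      linarith
    have h3 := le_mul_rpow_of_le_of_le (norm_nonneg _) hB0 (by positivity) (by positivity) hθ0 hθ1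
      h1 h2
    rwa [← Real.rpow_mul (norm_nonneg _), hθ, mul_div_cancel₀ _ hε.ne', ← hθ,
      ← Real.rpow_natCast_mul hq0.le, mul_comm (j : ℝ), Real.rpow_mul_natCast hq0.le] at h3
  have hHolder : ∃ M' : ℝ, ∀ w ∈ ball x r, ∀ w' ∈ ball x r,
      ‖fderiv ℝ (convolution K g (lsmul ℝ ℂ) volume) w
        - fderiv ℝ (convolution K g (lsmul ℝ ℂ) volume) w'‖ ≤ M' * ‖w - w'‖ ^ ε' := by
    refine ⟨B * ∑' j : ℕ, (q ^ (1 - θ)) ^ j, fun w hw w' hw' => ?_⟩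
    have hs : ∀ w ∈ ball x r, Summable fun j => D j w := fun w hw =>
      Summable.of_norm_bounded hsum1 fun j => hD1 j w hw
    rw [(hderiv w hw).fderiv, (hderiv w' hw').fderiv, ← (hs w hw).tsum_sub (hs w' hw')]
    exact tsum_of_norm_bounded ((hqsum.hasSum.mul_left B).mul_right _)
      fun j => hD3 j w hw w' hw'
  rw [← zero_add 1, HolderDerivOn.succ_iff isOpen_ball, HolderDerivOn.zero_iff]
  exact ⟨fun w hw => (hderiv w hw).differentiableAt.differentiableWithinAt,
    continuousOn_of_holder hε' hHolder, hHolder⟩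

open ContinuousLinearMap in
theorem holderDerivOn_succ_convolution {E : Type} [NormedAddCommGroup E] [NormedSpace ℝ E]
    [FiniteDimensional ℝ E] [MeasureSpace E] [BorelSpace E] [(volume : Measure E).IsAddHaarMeasure]
    {φ K : E → ℂ} {c : ℂ} {ρ r R ε ε' : ℝ} {x : E}
    (hφ : ContDiff ℝ 1 φ) (hφρ : Function.support φ ⊆ closedBall 0 ρ)
    (hc : ‖c‖ * 2 = 2 ^ Module.finrank ℝ E)
    (hK : ∀ z, HasSum (fun j : ℕ => c ^ j * φ ((2 : ℝ) ^ j • z)) (K z))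
    (hρ : 0 < ρ) (hr : 0 < r) (hR : r + ρ < R) (hε' : 0 < ε') (hεε : ε' < ε) (l : ℕ) :
    ∀ {F : Type} [NormedAddCommGroup F] [NormedSpace ℝ F] [NormedSpace ℂ F] [IsScalarTower ℝ ℂ F]
    [CompleteSpace F] {g : E → F} (_ : ContDiff ℝ l g) (_ : HasCompactSupport g)
    (_ : HolderDerivOn l ε g (ball x R)),
    HolderDerivOn (l + 1) ε' (convolution K g (lsmul ℝ ℂ) volume) (ball x r) := by
  have hKint : Integrable K := integrable_of_hasSum_dyadic hφ.continuous
    (HasCompactSupport.of_support_subset_isCompact (isCompact_closedBall 0 ρ) hφρ) hc hK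
  induction l with
  | zero =>
    intro F _ _ _ _ _ g hg hgs hH
    obtain ⟨M, hM⟩ := (HolderDerivOn.zero_iff.1 hH).2
    exact holderDerivOn_one_convolution hφ hφρ hc hK hρ hr hR hε' hεε hg.continuous hgs hM
  | succ l ih =>
    intro F _ _ _ _ _ g hg hgs hH
    have hg1 : ContDiff ℝ 1 g := hg.of_le (by simp)
    have hd : ∀ w, HasFDerivAt (convolution K g (lsmul ℝ ℂ) volume)
        (convolution K (fderiv ℝ g) (lsmul ℝ ℂ) volume w) w :=
      hgs.hasFDerivAt_convolution_right (lsmul ℝ ℂ) hKint.locallyIntegrable hg1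
    rw [HolderDerivOn.succ_iff isOpen_ball]
    refine ⟨fun w _ => (hd w).differentiableAt.differentiableWithinAt, ?_⟩
    rw [show fderiv ℝ (convolution K g (lsmul ℝ ℂ) volume)
      = convolution K (fderiv ℝ g) (lsmul ℝ ℂ) volume from funext fun w => (hd w).fderiv]
    exact ih (hg.fderiv_right (by simp)) (hgs.fderiv ℝ)
      ((HolderDerivOn.succ_iff isOpen_ball).1 hH).2

theorem exists_bound_one_add_norm_rpow {E F : Type*} [NormedAddCommGroup E] [NormedSpace ℝ E]
    [FiniteDimensional ℝ E] [NormedAddCommGroup F] {f : E → F} (hf : Continuous f) {a : ℝ}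
    (ha : 0 ≤ a) (h : f =O[cocompact E] fun y => ‖y‖ ^ (-a)) :
    ∃ C : ℝ, 0 ≤ C ∧ ∀ y, ‖f y‖ ≤ C * (1 + ‖y‖) ^ (-a) := by
  obtain ⟨C, hC0, hC⟩ := h.exists_nonneg
  have h1 : ∀ᶠ y : E in cocompact E, ‖f y‖ ≤ C * 2 ^ a * (1 + ‖y‖) ^ (-a) := by
    filter_upwards [hC.bound, (tendsto_norm_cocompact_atTop (E := E)).eventually_ge_atTop 1]
      with y hy hy1
    refine hy.trans ?_
    rw [Real.norm_of_nonneg (by positivity), mul_assoc]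
    refine mul_le_mul_of_nonneg_left ?_ hC0
    have h2 : ‖y‖ ^ (-a) = 2 ^ a * (2 * ‖y‖) ^ (-a) := by
      rw [Real.mul_rpow (by norm_num) (by positivity), ← mul_assoc,
        ← Real.rpow_add (by norm_num), add_neg_cancel, Real.rpow_zero, one_mul]
    rw [h2]
    exact mul_le_mul_of_nonneg_left
      (Real.rpow_le_rpow_of_nonpos (by positivity) (by linarith) (by linarith)) (by positivity)
  obtain ⟨t, ht, hts⟩ := mem_cocompact.1 h1
  have hcont : Continuous fun y : E => ‖f y‖ * (1 + ‖y‖) ^ a :=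
    hf.norm.mul (Continuous.rpow_const (by fun_prop) fun _ => Or.inr ha)
  obtain ⟨C', hC'⟩ := ht.exists_bound_of_continuousOn hcont.continuousOn
  refine ⟨max (C * 2 ^ a) C', le_max_of_le_left (by positivity), fun y => ?_⟩
  by_cases hy : y ∈ t
  · have h3 := hC' y hy
    rw [Real.norm_of_nonneg (by positivity)] at h3
    have h4 : ‖f y‖ ≤ C' * (1 + ‖y‖) ^ (-a) := by
      rw [Real.rpow_neg (by positivity), ← div_eq_mul_inv, le_div_iff₀ (by positivity)]
      exact h3
    exact h4.trans (mul_le_mul_of_nonneg_right (le_max_right _ _) (by positivity))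
  · exact (hts hy : _).trans (mul_le_mul_of_nonneg_right (le_max_left _ _) (by positivity))

/-- Far from the origin `K` is scaled by complex factors of size at most `t ^ (-s)`. -/
def ScalesAtInfty {E F : Type*} [NormedAddCommGroup E] [NormedSpace ℝ E] [NormedAddCommGroup F]
    [NormedSpace ℂ F] (ρ s : ℝ) (K : E → F) : Prop :=
  ∀ t : ℝ, 1 ≤ t → ∃ c : ℂ, ‖c‖ ≤ t ^ (-s) ∧ ∀ z, ρ < ‖z‖ → K (t • z) = c • K z

theorem ScalesAtInfty.exists_bound {E F : Type*} [NormedAddCommGroup E] [NormedSpace ℝ E]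
    [FiniteDimensional ℝ E] [NormedAddCommGroup F] [NormedSpace ℂ F] {ρ s : ℝ} {K : E → F}
    (hK : ScalesAtInfty ρ s K) (hc : Continuous K) (hρ : 0 < ρ) (hs : 0 ≤ s) :
    ∃ C : ℝ, 0 ≤ C ∧ ∀ z, ‖K z‖ ≤ C * (1 + ‖z‖) ^ (-s) := by
  obtain ⟨S, hS⟩ := (isCompact_closedBall (0 : E) (2 * ρ)).exists_bound_of_continuousOn
    hc.continuousOn
  have hS0 : 0 ≤ S := (norm_nonneg _).trans (hS 0 (by simp [hρ.le]))
  have key : ∀ z : E, ∀ t : ℝ, 1 ≤ t → 1 + ‖z‖ ≤ t * (1 + 2 * ρ) →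
      S * t ^ (-s) ≤ S * (1 + 2 * ρ) ^ s * (1 + ‖z‖) ^ (-s) := fun z t ht h => by
    rw [mul_assoc]
    refine mul_le_mul_of_nonneg_left ?_ hS0
    have h2 : t ^ (-s) = (1 + 2 * ρ) ^ s * (t * (1 + 2 * ρ)) ^ (-s) := by
      rw [Real.mul_rpow (by linarith) (by positivity), mul_left_comm,
        ← Real.rpow_add (by positivity), add_neg_cancel, Real.rpow_zero, mul_one]
    rw [h2]
    exact mul_le_mul_of_nonneg_left
      (Real.rpow_le_rpow_of_nonpos (by positivity) h (by linarith)) (by positivity)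
  refine ⟨S * (1 + 2 * ρ) ^ s, by positivity, fun z => ?_⟩
  rcases le_total ‖z‖ (2 * ρ) with hz | hz
  · have h1 := key z 1 le_rfl (by linarith)
    rw [Real.one_rpow, mul_one] at h1
    exact (hS z (by simpa using hz)).trans h1
  · set t : ℝ := ‖z‖ / (2 * ρ) with ht
    have ht1 : 1 ≤ t := (one_le_div (by positivity)).2 hz
    have ht0 : 0 < t := by linarith
    obtain ⟨c, hc1, hc2⟩ := hK t ht1
    have hz' : ‖t⁻¹ • z‖ = 2 * ρ := by
      have : ‖z‖ ≠ 0 := by intro h; rw [h] at hz; linarith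
      rw [norm_smul, Real.norm_of_nonneg (by positivity), ht]
      field_simp
    have h1 := hc2 (t⁻¹ • z) (by linarith)
    rw [smul_inv_smul₀ ht0.ne'] at h1
    rw [h1, norm_smul]
    calc ‖c‖ * ‖K (t⁻¹ • z)‖ ≤ t ^ (-s) * S := by
          gcongr
          exact hS _ (by simp [hz'])
      _ ≤ S * (1 + 2 * ρ) ^ s * (1 + ‖z‖) ^ (-s) := by
          rw [mul_comm]
          refine key z t ht1 ?_
          have : t * (2 * ρ) = ‖z‖ := div_mul_cancel₀ _ (by positivity)
          linarith

theorem ScalesAtInfty.fderiv {E F : Type*} [NormedAddCommGroup E] [NormedSpace ℝ E]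
    [NormedAddCommGroup F] [NormedSpace ℝ F] [NormedSpace ℂ F] [IsScalarTower ℝ ℂ F]
    {ρ s : ℝ} {K : E → F} (hK : ScalesAtInfty ρ s K) (hd : Differentiable ℝ K) :
    ScalesAtInfty ρ s (fderiv ℝ K) := by
  intro t ht
  obtain ⟨c, hc1, hc2⟩ := hK t ht
  have ht0 : 0 < t := by linarith
  refine ⟨(t : ℂ)⁻¹ * c, ?_, fun z hz => ?_⟩
  · rw [norm_mul, norm_inv, norm_real, Real.norm_of_nonneg ht0.le]
    exact (mul_le_of_le_one_left (norm_nonneg c) (inv_le_one_of_one_le₀ ht)).trans hc1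
  · have h1 : (fun z => K (t • z)) =ᶠ[nhds z] fun z => c • K z := by
      filter_upwards [(isOpen_lt continuous_const continuous_norm).mem_nhds hz] with u hu
      exact hc2 u hu
    have h2 := h1.fderiv_eq (𝕜 := ℝ)
    rw [fderiv_comp_smul, fderiv_fun_const_smul (hd z)] at h2
    rw [mul_smul, ← ofReal_inv, ← Complex.coe_algebraMap, algebraMap_smul]
    exact (eq_inv_smul_iff₀ ht0.ne').2 h2

section FarField

variable {E : Type} [NormedAddCommGroup E] [NormedSpace ℝ E] [FiniteDimensional ℝ E]
  [MeasureSpace E] [BorelSpace E] [(volume : Measure E).IsAddHaarMeasure]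
  {f : E → ℂ} {a s ρ C : ℝ}

theorem integrable_far_bound (ha : Module.finrank ℝ E < a + s) (B : ℝ) :
    Integrable fun y : E => B * (1 + ‖y‖) ^ (-(a + s)) :=
  (integrable_one_add_norm ha).const_mul B

theorem norm_smul_far_le {E F : Type*} [NormedAddCommGroup E] [NormedAddCommGroup F]
    [NormedSpace ℂ F] {f : E → ℂ} {a s C C' r : ℝ} {K : E → F} (hs : 0 ≤ s) (hC0 : 0 ≤ C)
    (hC'0 : 0 ≤ C') (hf : ∀ y, ‖f y‖ ≤ C * (1 + ‖y‖) ^ (-a))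
    (hK : ∀ z, ‖K z‖ ≤ C' * (1 + ‖z‖) ^ (-s)) {w : E} (hw : ‖w‖ ≤ r) (y : E) :
    ‖f y • K (w - y)‖ ≤ C * C' * (1 + r) ^ s * (1 + ‖y‖) ^ (-(a + s)) := by
  have hr : 0 ≤ r := (norm_nonneg w).trans hw
  have h1 : (1 + ‖w - y‖) ^ (-s) ≤ (1 + r) ^ s * (1 + ‖y‖) ^ (-s) := by
    have h2 : (1 + ‖w - y‖) ^ (-s) = (1 + r) ^ s * ((1 + r) * (1 + ‖w - y‖)) ^ (-s) := by
      rw [Real.mul_rpow (by positivity) (by positivity), ← mul_assoc,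
        ← Real.rpow_add (by positivity), add_neg_cancel, Real.rpow_zero, one_mul]
    rw [h2]
    refine mul_le_mul_of_nonneg_left (Real.rpow_le_rpow_of_nonpos (by positivity) ?_ (by linarith))
      (by positivity)
    have h3 : ‖y‖ ≤ ‖w‖ + ‖w - y‖ := by
      simpa using norm_sub_le w (w - y)
    nlinarith [norm_nonneg (w - y), mul_nonneg hr (norm_nonneg (w - y))]
  rw [norm_smul, neg_add, Real.rpow_add (by positivity)]
  calc ‖f y‖ * ‖K (w - y)‖
      ≤ (C * (1 + ‖y‖) ^ (-a)) * (C' * ((1 + r) ^ s * (1 + ‖y‖) ^ (-s))) :=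
        mul_le_mul (hf y) ((hK _).trans (mul_le_mul_of_nonneg_left h1 hC'0)) (norm_nonneg _)
          (by positivity)
    _ = _ := by ring

theorem integrable_smul_far {F : Type*} [NormedAddCommGroup F] [NormedSpace ℝ F] [NormedSpace ℂ F]
    {K : E → F} (hfc : Continuous f) (hC0 : 0 ≤ C) (hf : ∀ y, ‖f y‖ ≤ C * (1 + ‖y‖) ^ (-a))
    (hρ : 0 < ρ) (hs : 0 ≤ s) (ha : Module.finrank ℝ E < a + s)
    (hK : Continuous K) (hKs : ScalesAtInfty ρ s K) (w : E) :
    Integrable fun y => f y • K (w - y) := by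
  obtain ⟨C', hC'0, hC'⟩ := hKs.exists_bound hK hρ hs
  exact (integrable_far_bound ha (C * C' * (1 + ‖w‖) ^ s)).mono'
    (Continuous.aestronglyMeasurable (by fun_prop))
    (.of_forall (norm_smul_far_le hs hC0 hC'0 hf hC' le_rfl))

theorem contDiff_integral_smul_far (hfc : Continuous f) (hC0 : 0 ≤ C)
    (hf : ∀ y, ‖f y‖ ≤ C * (1 + ‖y‖) ^ (-a)) (hρ : 0 < ρ) (hs : 0 ≤ s)
    (ha : Module.finrank ℝ E < a + s) (m : ℕ) :
    ∀ {F : Type} [NormedAddCommGroup F] [NormedSpace ℝ F] [NormedSpace ℂ F] [IsScalarTower ℝ ℂ F]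
    {K : E → F} (_ : ContDiff ℝ (m + 1) K) (_ : ScalesAtInfty ρ s K),
    ContDiff ℝ m fun w => ∫ y, f y • K (w - y) := by
  have key : ∀ {F : Type} [NormedAddCommGroup F] [NormedSpace ℝ F] [NormedSpace ℂ F]
      [IsScalarTower ℝ ℂ F] {K : E → F} (_ : ContDiff ℝ 1 K) (_ : ScalesAtInfty ρ s K) (w : E),
      HasFDerivAt (fun w => ∫ y, f y • K (w - y)) (∫ y, f y • fderiv ℝ K (w - y)) w := by
    intro F _ _ _ _ K hK hKs w
    have hd := hK.differentiable one_ne_zero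
    have hDc := hK.continuous_fderiv one_ne_zero
    obtain ⟨C', hC'0, hC'⟩ := (hKs.fderiv hd).exists_bound hDc hρ hs
    refine hasFDerivAt_integral_of_dominated_of_fderiv_le (ball_mem_nhds w one_pos)
      (F' := fun w y => f y • fderiv ℝ K (w - y))
      (.of_forall fun v => Continuous.aestronglyMeasurable (by fun_prop))
      (integrable_smul_far hfc hC0 hf hρ hs ha hK.continuous hKs w)
      (Continuous.aestronglyMeasurable (by fun_prop))
      (.of_forall fun y v hv =>
        norm_smul_far_le hs hC0 hC'0 hf hC' (r := ‖w‖ + 1) ?_ y)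
      (integrable_far_bound ha _) (.of_forall fun y v _ => ?_)
    · have h1 := norm_le_norm_add_norm_sub' v w
      have h2 := mem_ball_iff_norm.1 hv
      linarith
    · have h1 : HasFDerivAt (fun v => K (v - y)) (fderiv ℝ K (v - y)) v :=
        (hasFDerivAt_comp_sub y).2 (hd (v - y)).hasFDerivAt
      exact h1.const_smul (f y)
  induction m with
  | zero =>
    intro F _ _ _ _ K hK hKs
    rw [Nat.cast_zero, contDiff_zero]
    exact continuous_iff_continuousAt.2 fun w => (key (by simpa using hK) hKs w).continuousAt
  | succ m ih =>
    intro F _ _ _ _ K hK hKs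
    have hK1 : ContDiff ℝ 1 K := hK.of_le (by simp)
    rw [Nat.cast_succ, contDiff_succ_iff_hasFDerivAt]
    exact ⟨_, ih (hK.fderiv_right (by simp)) (hKs.fderiv (hK1.differentiable one_ne_zero)),
      key hK1 hKs⟩

end FarField

section PowerKernel

variable {E : Type*} [NormedAddCommGroup E] [InnerProductSpace ℝ E]

theorem contDiffAt_norm_cpow (β : ℂ) {z : E} (hz : z ≠ 0) {m : WithTop ℕ∞} :
    ContDiffAt ℝ m (fun z : E => (‖z‖ : ℂ) ^ β) z := by
  have h1 : ContDiffAt ℝ m (fun z : E => Complex.exp (((Real.log ‖z‖ : ℝ) : ℂ) * β)) z :=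
    ((ofRealCLM.contDiff.contDiffAt.comp z
      ((contDiffAt_norm ℝ hz).log (norm_ne_zero_iff.2 hz))).mul contDiffAt_const).cexp
  refine h1.congr_of_eventuallyEq ?_
  filter_upwards [isOpen_ne.mem_nhds hz] with y hy
  rw [cpow_def_of_ne_zero (by simpa using hy), ofReal_log (norm_nonneg y)]

theorem contDiff_mul_norm_cpow (β : ℂ) {m : WithTop ℕ∞} {χ : E → ℂ} (hχ : ContDiff ℝ m χ)
    (h0 : χ =ᶠ[nhds 0] 0) : ContDiff ℝ m fun z => χ z * (‖z‖ : ℂ) ^ β := by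
  rw [contDiff_iff_contDiffAt]
  intro z
  rcases eq_or_ne z 0 with rfl | hz
  · refine contDiffAt_const (c := (0 : ℂ)) |>.congr_of_eventuallyEq ?_
    filter_upwards [h0] with y hy
    simp [hy]
  · exact hχ.contDiffAt.mul (contDiffAt_norm_cpow β hz)

theorem norm_smul_cpow {t : ℝ} (ht : 0 ≤ t) (β : ℂ) (z : E) :
    (‖t • z‖ : ℂ) ^ β = (t : ℂ) ^ β * (‖z‖ : ℂ) ^ β := by
  rw [norm_smul, Real.norm_of_nonneg ht, ofReal_mul, mul_cpow_ofReal_nonneg ht (norm_nonneg z)]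

theorem scalesAtInfty_mul_norm_cpow (β : ℂ) {χ : E → ℂ} {ρ : ℝ}
    (hχ : ∀ z, ρ < ‖z‖ → χ z = 1) :
    ScalesAtInfty ρ (-β.re) fun z => χ z * (‖z‖ : ℂ) ^ β := by
  intro t ht
  have ht0 : 0 < t := by linarith
  refine ⟨(t : ℂ) ^ β, ?_, fun z hz => ?_⟩
  · rw [norm_cpow_eq_rpow_re_of_pos ht0, neg_neg]
  · have h1 : ρ < ‖t • z‖ := by
      rw [norm_smul, Real.norm_of_nonneg ht0.le]
      exact hz.trans_le (le_mul_of_one_le_left (norm_nonneg z) ht)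
    simp only [hχ _ hz, hχ _ h1, norm_smul_cpow ht0.le, smul_eq_mul, one_mul]

theorem hasSum_dyadic_norm_cpow {β : ℂ} (hβ : β ≠ 0) {χ : E → ℂ} {ρ : ℝ}
    (hχ : ∀ z, ρ ≤ ‖z‖ → χ z = 0) (z : E) :
    HasSum (fun j : ℕ => ((2 : ℂ) ^ (-β)) ^ j *
      ((χ ((2 : ℝ) ^ j • z) - χ ((2 : ℝ) • (2 : ℝ) ^ j • z)) * (‖(2 : ℝ) ^ j • z‖ : ℂ) ^ β))
      (χ z * (‖z‖ : ℂ) ^ β) := by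
  rcases eq_or_ne z 0 with rfl | hz
  · simp [hβ]
  have hterm : ∀ j : ℕ, ((2 : ℂ) ^ (-β)) ^ j *
      ((χ ((2 : ℝ) ^ j • z) - χ ((2 : ℝ) • (2 : ℝ) ^ j • z)) * (‖(2 : ℝ) ^ j • z‖ : ℂ) ^ β)
      = (χ ((2 : ℝ) ^ j • z) - χ ((2 : ℝ) ^ (j + 1) • z)) * (‖z‖ : ℂ) ^ β := fun j => by
    have h1 : (((2 : ℝ) ^ j : ℝ) : ℂ) ^ β = ((2 : ℂ) ^ β) ^ j := by
      induction j with
      | zero => simp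
      | succ j ih =>
        rw [pow_succ, ofReal_mul, mul_cpow_ofReal_nonneg (by positivity) zero_le_two, ih,
          pow_succ, ofReal_ofNat]
    rw [norm_smul_cpow (by positivity), h1, smul_smul, ← pow_succ', cpow_neg, inv_pow]
    have h2 : ((2 : ℂ) ^ β) ^ j ≠ 0 := pow_ne_zero _ (by simp [cpow_eq_zero_iff])
    field_simp
  simp_rw [hterm]
  refine HasSum.mul_right _ ?_
  obtain ⟨N, hN⟩ := pow_unbounded_of_one_lt (ρ / ‖z‖) one_lt_two
  have hz' : 0 < ‖z‖ := norm_pos_iff.2 hz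
  have hzero : ∀ j, N ≤ j → χ ((2 : ℝ) ^ j • z) = 0 := fun j hj => by
    refine hχ _ ?_
    rw [norm_smul, norm_pow, Real.norm_two, ← div_le_iff₀ hz']
    exact hN.le.trans (pow_le_pow_right₀ one_le_two hj)
  have h := hasSum_sum_of_ne_finset_zero (L := .unconditional ℕ) (s := Finset.range N)
    (f := fun j : ℕ => χ ((2 : ℝ) ^ j • z) - χ ((2 : ℝ) ^ (j + 1) • z)) (fun j hj => by
      have hj' : N ≤ j := by simpa using hj
      rw [hzero j hj', hzero (j + 1) (by lia), sub_zero])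
  rwa [Finset.sum_range_sub' (fun j => χ ((2 : ℝ) ^ j • z)), hzero N le_rfl, sub_zero, pow_zero,
    one_smul] at h

/-- Splitting of `‖z‖ ^ β` into a dyadic sum supported near the origin and a smooth part. -/
theorem exists_split_norm_cpow [FiniteDimensional ℝ E] {β : ℂ} (hβ : β ≠ 0)
    (hre : β.re = 1 - Module.finrank ℝ E) {ρ : ℝ} (hρ : 0 < ρ) :
    ∃ (φ K₁ K₂ : E → ℂ) (c : ℂ), ContDiff ℝ 1 φ ∧ Function.support φ ⊆ closedBall 0 ρ ∧
      ‖c‖ * 2 = 2 ^ Module.finrank ℝ E ∧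
      (∀ z, HasSum (fun j : ℕ => c ^ j * φ ((2 : ℝ) ^ j • z)) (K₁ z)) ∧
      (∀ z, ρ < ‖z‖ → K₁ z = 0) ∧
      (∀ m : ℕ, ContDiff ℝ m K₂) ∧ ScalesAtInfty ρ (Module.finrank ℝ E - 1) K₂ ∧
      ∀ z, (‖z‖ : ℂ) ^ β = K₁ z + K₂ z := by
  let ψ : ContDiffBump (0 : E) := ⟨ρ / 2, ρ, by positivity, by linarith⟩
  set χ : E → ℂ := fun z => ((ψ z : ℝ) : ℂ) with hχ
  have hχC : ∀ m : ℕ, ContDiff ℝ m χ := fun m =>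
    ofRealCLM.contDiff.comp (ψ.contDiff (n := (m : ℕ∞)))
  have hχ0 : ∀ z, ρ ≤ ‖z‖ → χ z = 0 := fun z hz => by
    rw [hχ, ofReal_eq_zero]
    exact ψ.zero_of_le_dist (by simpa using hz)
  have hχ1 : ∀ z, ‖z‖ ≤ ρ / 2 → χ z = 1 := fun z hz => by
    rw [hχ, ofReal_eq_one]
    exact ψ.one_of_mem_closedBall (by simpa using hz)
  have hsmall : ∀ᶠ z : E in nhds 0, ‖z‖ ≤ ρ / 4 := by
    filter_upwards [closedBall_mem_nhds (0 : E) (by positivity : 0 < ρ / 4)] with z hz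
    simpa using hz
  refine ⟨fun z => (χ z - χ ((2 : ℝ) • z)) * (‖z‖ : ℂ) ^ β, fun z => χ z * (‖z‖ : ℂ) ^ β,
    fun z => (1 - χ z) * (‖z‖ : ℂ) ^ β, (2 : ℂ) ^ (-β), ?_, fun z hz => ?_, ?_,
    hasSum_dyadic_norm_cpow hβ hχ0, fun z hz => ?_, fun m => ?_, ?_, fun z => by ring⟩
  · refine contDiff_mul_norm_cpow β ((hχC 1).sub ((hχC 1).comp (by fun_prop))) ?_
    filter_upwards [hsmall] with z hz
    have h2 : ‖(2 : ℝ) • z‖ ≤ ρ / 2 := by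
      rw [norm_smul, Real.norm_two]
      linarith
    simp [hχ1 z (by linarith), hχ1 _ h2]
  · rw [mem_closedBall_zero_iff]
    by_contra! h
    refine hz ?_
    have h2 : ρ ≤ ‖(2 : ℝ) • z‖ := by
      rw [norm_smul, Real.norm_two]
      linarith
    simp only [hχ0 z h.le, hχ0 _ h2, sub_zero, zero_mul]
  · rw [← ofReal_ofNat, norm_cpow_eq_rpow_re_of_pos two_pos, neg_re, hre, neg_sub,
      Real.rpow_sub_one two_ne_zero, Real.rpow_natCast, div_mul_cancel₀ _ two_ne_zero]
  · simp only [hχ0 z hz.le, zero_mul]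
  · refine contDiff_mul_norm_cpow β (contDiff_const.sub (hχC m)) ?_
    filter_upwards [hsmall] with z hz
    simp [hχ1 z (by linarith)]
  · have h := scalesAtInfty_mul_norm_cpow β (χ := fun z => 1 - χ z)
      (fun z hz => by rw [hχ0 z hz.le, sub_zero])
    rwa [hre, neg_sub] at h

end PowerKernel

/-- The Riesz potential gains one derivative in local Hölder classes, up to an arbitrarily small
loss of the index. -/
theorem holderDerivOn_succ_integral_norm_cpow {E : Type} [NormedAddCommGroup E]
    [InnerProductSpace ℝ E] [FiniteDimensional ℝ E] [MeasureSpace E] [BorelSpace E]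
    [(volume : Measure E).IsAddHaarMeasure] [Nontrivial E] {a ε ε' : ℝ} {l : ℕ} {x : E}
    {f : E → ℂ} {β : ℂ} {O : Set E} (ha : 1 < a) (hfc : Continuous f)
    (hdecay : f =O[cocompact E] fun y => ‖y‖ ^ (-a)) (hβ : β ≠ 0)
    (hre : β.re = 1 - Module.finrank ℝ E) (hO : IsOpen O) (hxO : x ∈ O) (hε' : 0 < ε')
    (hεε : ε' < ε) (hε1 : ε < 1) (hf : HolderDerivOn l ε f O) :
    ∃ r > 0, HolderDerivOn (l + 1) ε' (fun w => ∫ y, f y * (‖w - y‖ : ℂ) ^ β) (ball x r) := by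
  obtain ⟨R₀, hR₀, hRO⟩ := nhds_basis_closedBall.mem_iff.1 (hO.mem_nhds hxO)
  set R := R₀ / 2 with hR
  have hR0 : 0 < R := by positivity
  let ψ : ContDiffBump x := ⟨R, R₀, hR0, by linarith⟩
  set g : E → ℂ := fun y => ψ y • f y with hg
  have hgf : ∀ y ∈ ball x R, g y = f y := fun y hy => by
    have : ψ y = 1 := ψ.one_of_mem_closedBall (ball_subset_closedBall hy)
    simp [hg, this]
  have hgs : HasCompactSupport g := ψ.hasCompactSupport.smul_right
  have hgl : ContDiff ℝ l g := by
    refine contDiff_iff_contDiffAt.2 fun y => ?_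
    by_cases hy : y ∈ tsupport g
    swap
    · exact contDiffAt_const.congr_of_eventuallyEq (notMem_tsupport_iff_eventuallyEq.1 hy)
    have hyO : y ∈ O := hRO (ψ.tsupport_eq ▸ tsupport_smul_subset_left _ _ hy)
    exact (ψ.contDiff (n := (l : ℕ∞))).contDiffAt.smul (hf.1.contDiffAt (hO.mem_nhds hyO))
  have hgH : HolderDerivOn l ε g (ball x R) :=
    (hf.mono ((ball_subset_closedBall.trans (closedBall_subset_closedBall (by linarith))).trans
      hRO)).congr isOpen_ball hgf
  obtain ⟨C, hC0, hC⟩ := exists_bound_one_add_norm_rpow hfc (by linarith) hdecay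
  obtain ⟨φ, K₁, K₂, c, hφ, hφρ, hc, hK₁, hK₁0, hK₂, hK₂s, hsplit⟩ :=
    exists_split_norm_cpow (E := E) hβ hre (ρ := R / 4) (by positivity)
  have hn : (1 : ℝ) ≤ Module.finrank ℝ E := by exact_mod_cast Module.finrank_pos
  have hK₁i : Integrable K₁ := integrable_of_hasSum_dyadic hφ.continuous
    (HasCompactSupport.of_support_subset_isCompact (isCompact_closedBall 0 (R / 4)) hφρ) hc hK₁
  have hint₁ : ∀ w, Integrable fun y => f y * K₁ (w - y) := fun w =>
    (hK₁i.comp_sub_left w).bdd_mul hfc.aestronglyMeasurable (c := C) (.of_forall fun y =>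
      (hC y).trans (mul_le_of_le_one_right hC0
        (Real.rpow_le_one_of_one_le_of_nonpos (by simp) (by linarith))))
  have hint₂ : ∀ w, Integrable fun y => f y * K₂ (w - y) := fun w =>
    integrable_smul_far hfc hC0 hC (by positivity) (by linarith) (by linarith)
      (hK₂ 0).continuous hK₂s w
  have hfar : ContDiff ℝ ((l + 1 : ℕ) + 1) fun w => ∫ y, f y * K₂ (w - y) := by
    exact_mod_cast contDiff_integral_smul_far hfc hC0 hC (by positivity) (by linarith)
      (by linarith) (l + 1 + 1) (by exact_mod_cast hK₂ (l + 1 + 1 + 1)) hK₂s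
  obtain ⟨r, hr, hfarH⟩ := HolderDerivOn.exists_of_contDiff hε' (hεε.trans hε1) hfar x
  have hnear := holderDerivOn_succ_convolution (r := R / 2) hφ hφρ hc hK₁ (by positivity)
    (by positivity) (by linarith) hε' hεε l hgl hgs hgH
  refine ⟨min (R / 2) r, by positivity, ?_⟩
  refine ((hnear.mono (ball_subset_ball (min_le_left _ _))).add isOpen_ball
    (hfarH.mono (ball_subset_ball (min_le_right _ _)))).congr isOpen_ball fun w hw => ?_
  have hw' := mem_ball_iff_norm.1 hw
  have hwR : ‖w - x‖ < R / 2 := hw'.trans_le (min_le_left _ _)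
  simp only [Pi.add_apply, hsplit, mul_add]
  rw [integral_add (hint₁ w) (hint₂ w)]
  congr 1
  rw [← integral_sub_left_eq_self _ volume w]
  refine integral_congr_ae (.of_forall fun z => ?_)
  simp only [sub_sub_cancel, ContinuousLinearMap.lsmul_apply, smul_eq_mul]
  rcases lt_or_ge (R / 4) ‖z‖ with hz | hz
  · simp [hK₁0 z hz]
  · rw [hgf, mul_comm]
    rw [mem_ball_iff_norm]
    calc ‖w - z - x‖ = ‖(w - x) - z‖ := by congr 1; abel
      _ ≤ ‖w - x‖ + ‖z‖ := norm_sub_le _ _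
      _ < R := by linarith

theorem stmt_10 (a : ℝ) (ha : 1 < a) (l : ℕ) (ε : ℝ) (hε0 : 0 < ε) (hε1 : ε < 1)
    (n : ℕ) (hn : 0 < n) (x : EuclideanSpace ℝ (Fin n))
    (f : EuclideanSpace ℝ (Fin n) → ℂ) (hfc : Continuous f)
    (hdecay : f =O[cocompact (EuclideanSpace ℝ (Fin n))] fun y => ‖y‖ ^ (-a))
    (α : ℂ) (hα : α.re = 1) (hαpole : ∀ m : ℕ, α ≠ (n : ℂ) + 2 * m)
    (O : Set (EuclideanSpace ℝ (Fin n))) (hO : IsOpen O) (hxO : x ∈ O)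
    (hCl : ContDiffOn ℝ l f O)
    (M : ℝ) (hHolder : ∀ x₁ ∈ O, ∀ x₂ ∈ O,
      ‖iteratedFDerivWithin ℝ l f O x₁ - iteratedFDerivWithin ℝ l f O x₂‖ ≤ M * ‖x₁ - x₂‖ ^ ε) :
    ∀ ε' : ℝ, 0 < ε' → ε' < ε →
      ∃ V : Set (EuclideanSpace ℝ (Fin n)), IsOpen V ∧ x ∈ V ∧
        ContDiffOn ℝ (l + 1) (riesz n f α) V ∧
        ∃ M' : ℝ, ∀ x₁ ∈ V, ∀ x₂ ∈ V,
          ‖iteratedFDerivWithin ℝ (l + 1) (riesz n f α) V x₁ -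
            iteratedFDerivWithin ℝ (l + 1) (riesz n f α) V x₂‖ ≤ M' * ‖x₁ - x₂‖ ^ ε' := by
  intro ε' hε' hεε
  have : Nonempty (Fin n) := ⟨⟨0, hn⟩⟩
  have hf : HolderDerivOn l ε f O := ⟨hCl, M, fun x₁ h₁ x₂ h₂ => by
    rw [← iteratedFDerivWithin_of_isOpen l hO h₁, ← iteratedFDerivWithin_of_isOpen l hO h₂]
    exact hHolder x₁ h₁ x₂ h₂⟩
  have hβ : α - n ≠ 0 := by
    rw [sub_ne_zero]
    simpa using hαpole 0
  obtain ⟨r, hr, hI⟩ := holderDerivOn_succ_integral_norm_cpow ha hfc hdecay hβ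
    (by simp [hα]) hO hxO hε' hεε hε1 hf
  obtain ⟨hC, M', hM'⟩ := hI.const_smul (Hfun n α)⁻¹ isOpen_ball
  refine ⟨ball x r, isOpen_ball, mem_ball_self hr, by exact_mod_cast hC, M',
    fun x₁ h₁ x₂ h₂ => ?_⟩
  rw [iteratedFDerivWithin_of_isOpen _ isOpen_ball h₁,
    iteratedFDerivWithin_of_isOpen _ isOpen_ball h₂]
  exact hM' x₁ h₁ x₂ h₂
end
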